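/- The unique measure of maximal entropy on the squarefree flow (X, σ) is ι_*(m × ω_{(1/2,1/2)}), the pushforward under the insertion map ι of the product of the Haar probability measure m on G = ∏_p ℤ/p²ℤ with the (1/2,1/2) Bernoulli measure ω_{(1/2,1/2)} on Ω⁽²⁾; equivalently, m × ω_{(1/2,1/2)} is the unique measure of maximal entropy for the skew product (G × Ω⁽²⁾, T) and its image under ι is the unique measure of maximal entropy for (X, σ). -/

import Mathlib

open MeasureTheory Filter Set
open scoped ENNReal Classical

noncomputable section

/-- The sequence space `{0,1}^{ℕ*}`; index `n : ℕ` represents the positive integer `n + 1`. -/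
abbrev Omega2 : Type := ℕ → Bool

/-- The left shift `(σ x)_n = x_{n+1}`. -/
def shift : Omega2 → Omega2 := fun x n => x (n + 1)

/-- `x` omits the residue class `a` modulo `q` (the position of index `n` is `n + 1`). -/
def OmitsMod (x : Omega2) (q : ℕ) (a : ZMod q) : Prop :=
  ∀ n : ℕ, ((n + 1 : ℕ) : ZMod q) = a → x n = false

/-- The squarefree flow: sequences whose support omits at least one residue class
modulo `p ^ 2` for every prime `p`. -/
def SqfFlow : Set Omega2 :=
  {x | ∀ p : Nat.Primes, ∃ a : ZMod ((p : ℕ) ^ 2), OmitsMod x ((p : ℕ) ^ 2) a}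

instance (p : Nat.Primes) : NeZero ((p : ℕ) ^ 2) := ⟨pow_ne_zero 2 p.2.ne_zero⟩
instance (n : ℕ) : MeasurableSpace (ZMod n) := ⊤
instance (n : ℕ) : TopologicalSpace (ZMod n) := ⊥
instance (n : ℕ) : DiscreteTopology (ZMod n) := ⟨rfl⟩

/-- The group `G = ∏_p ℤ/p²ℤ`. -/
abbrev G : Type := ∀ p : Nat.Primes, ZMod ((p : ℕ) ^ 2)

/-- Translation by `(-1, -1, -1, …)` on `G`. -/
def T1 : G → G := fun g p => g p - 1

/-- `G₁ = {g : g_p ≡ 1 mod p² for some prime p}`. -/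
def G1 : Set G := {g | ∃ p : Nat.Primes, g p = 1}

/-- Shannon entropy of the finite partition of `α` induced by `f`. -/
def partH {α β : Type*} [MeasurableSpace α] [Fintype β] (μ : Measure α) (f : α → β) : ℝ :=
  ∑ b : β, Real.negMulLog ((μ (f ⁻¹' {b})).toReal)

/-- Entropy of the process generated by the observable `f` under `T`. -/
def procH {α : Type*} [MeasurableSpace α] (μ : Measure α) (T : α → α)
    {k : ℕ} (f : α → Fin k) : ℝ :=
  ⨅ n : ℕ, partH μ (fun x (i : Fin (n + 1)) => f (T^[(i : ℕ)] x)) / (n + 1)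

/-- Kolmogorov–Sinai entropy of `T` with respect to `μ`: supremum over finite measurable
partitions (encoded as finite-valued measurable observables). -/
def ksEntropy {α : Type*} [MeasurableSpace α] (μ : Measure α) (T : α → α) : EReal :=
  ⨆ (k : ℕ) (f : α → Fin k) (_ : Measurable f), ((procH μ T f : ℝ) : EReal)

/-- First return time (`0` if the point never returns). -/
def retTime {α : Type*} (T : α → α) (Y : Set α) (x : α) : ℕ :=
  sInf {n : ℕ | 0 < n ∧ T^[n] x ∈ Y}

/-- Induced (first–return) transformation, as a map of the ambient space. -/
def inducedAmb {α : Type*} (T : α → α) (Y : Set α) (x : α) : α :=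
  T^[retTime T Y x] x

/-- Number of omitted residue classes modulo `q`. -/
def numOmitted (x : Omega2) (q : ℕ) : ℕ := Set.ncard {a : ZMod q | OmitsMod x q a}

/-- `x` is persistent modulo `q`: every residue class meeting the support meets it infinitely. -/
def Persistent (x : Omega2) (q : ℕ) : Prop :=
  ∀ a : ZMod q, (∃ n : ℕ, ((n + 1 : ℕ) : ZMod q) = a ∧ x n = true) →
    {n : ℕ | ((n + 1 : ℕ) : ZMod q) = a ∧ x n = true}.Infinite

/-- The set of `p`-persistent sequences in the squarefree flow. -/
def SP (p : Nat.Primes) : Set Omega2 := {x ∈ SqfFlow | Persistent x ((p : ℕ) ^ 2)}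

/-- `X_I`: sequences omitting exactly `I p` classes mod `p²` and persistent for every `p`. -/
def XI (I : Nat.Primes → ℕ) : Set Omega2 :=
  {x ∈ SqfFlow | (∀ p : Nat.Primes, numOmitted x ((p : ℕ) ^ 2) = I p) ∧
    ∀ p : Nat.Primes, Persistent x ((p : ℕ) ^ 2)}

/-- `X₁ = X_{(1,1,1,…)}`. -/
def X1 : Set Omega2 := XI fun _ => 1

/-- `ρ(x)_p` is the (unique, for `x ∈ X₁`) omitted residue class mod `p²`. -/
def rho (x : Omega2) : G := fun p =>
  if h : ∃ a : ZMod ((p : ℕ) ^ 2), OmitsMod x ((p : ℕ) ^ 2) a then h.choose else 0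

/-- `Y = ρ⁻¹(G₁ᶜ) ⊆ X₁`. -/
def Y : Set Omega2 := {x ∈ X1 | rho x ∈ G1ᶜ}

/-- `α_g(m) = #{1 ≤ n ≤ m : n ≡ g_p mod p² for some prime p}`. -/
def alphaG (g : G) (m : ℕ) : ℕ :=
  Set.ncard {n : ℕ | 1 ≤ n ∧ n ≤ m ∧ ∃ p : Nat.Primes, ((n : ℕ) : ZMod ((p : ℕ) ^ 2)) = g p}

/-- The insertion map `ι : G × Ω⁽²⁾ → X`; position of index `n` is `m = n + 1`, and the
`1`-based value `y_{m - α_g(m)}` is the `0`-based entry `y (n - α_g(n+1))`. -/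
def iota (g : G) (y : Omega2) : Omega2 := fun n =>
  if ∃ p : Nat.Primes, ((n + 1 : ℕ) : ZMod ((p : ℕ) ^ 2)) = g p then false
  else y (n - alphaG g (n + 1))

/-- The skew product `T(g,y) = (T₁ g, σ^{ψ(g)} y)`, `ψ = 1 - 1_{G₁}`. -/
def skewT : G × Omega2 → G × Omega2 := fun gy =>
  if gy.1 ∈ G1 then (T1 gy.1, gy.2) else (T1 gy.1, shift gy.2)

/-- `G₁ᶜ × Ω⁽²⁾` as a subset of `G × Ω⁽²⁾`. -/
def ZSet : Set (G × Omega2) := G1ᶜ ×ˢ (Set.univ : Set Omega2)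

/-- `x̂`: delete from `x` the entries at positions congruent to `(g_x)_p` mod `p²` for some `p`. -/
def hat (x : Omega2) : Omega2 := fun m =>
  x (Nat.nth (fun j => ¬ ∃ p : Nat.Primes, ((j + 1 : ℕ) : ZMod ((p : ℕ) ^ 2)) = rho x p) m)

/-- A Haar probability measure on `G`: a translation-invariant Borel probability measure. -/
def IsHaarLike (m : Measure G) : Prop :=
  IsProbabilityMeasure m ∧ ∀ g : G, MeasurePreserving (fun h => g + h) m m

/-- The `(1/2, 1/2)` Bernoulli measure on `Ω⁽²⁾`, characterized by its cylinder values. -/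
def IsBernoulliHalf (ω : Measure Omega2) : Prop :=
  IsProbabilityMeasure ω ∧
    ∀ (s : Finset ℕ) (v : ℕ → Bool), ω {x | ∀ i ∈ s, x i = v i} = (1 / 2 : ℝ≥0∞) ^ s.card

/-- Normalized restriction of a measure on `G` to `G₁ᶜ`. -/
def mbar (m : Measure G) : Measure G := (m G1ᶜ)⁻¹ • m.restrict G1ᶜ

/-- The `k`-th prime (`0`-indexed), as an element of `Nat.Primes`. -/
def nthPrime (k : ℕ) : Nat.Primes := ⟨Nat.nth Nat.Prime k, Nat.prime_nth_prime k⟩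

/-- `X(r)`: sequences omitting at least one class mod `p_i²` for the first `r` primes. -/
def Xr (r : ℕ) : Set Omega2 :=
  {x | ∀ k : Fin r, ∃ a : ZMod ((nthPrime k : ℕ) ^ 2), OmitsMod x ((nthPrime k : ℕ) ^ 2) a}

/-- `X_I(r)`: elements of `X(r)` omitting exactly `I k` classes mod `p_k²` for `k ≤ r`. -/
def XIr (r : ℕ) (I : Fin r → ℕ) : Set Omega2 :=
  {x ∈ Xr r | ∀ k : Fin r, numOmitted x ((nthPrime k : ℕ) ^ 2) = I k}

/-- Number of distinct words of length `L` occurring in elements of `F`. -/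
def wordCount (F : Set Omega2) (L : ℕ) : ℕ :=
  Set.ncard {w : Fin L → Bool | ∃ x ∈ F, ∃ j : ℕ, ∀ t : Fin L, w t = x (j + (t : ℕ))}

/-- `α_g^r(m)`, counting only the first `r` primes. -/
def alphaGr (r : ℕ) (g : G) (m : ℕ) : ℕ :=
  Set.ncard {n : ℕ | 1 ≤ n ∧ n ≤ m ∧
    ∃ k : Fin r, ((n : ℕ) : ZMod ((nthPrime k : ℕ) ^ 2)) = g (nthPrime k)}

/-- The partial insertion map `ι_r`. -/
def iotaR (r : ℕ) (g : G) (y : Omega2) : Omega2 := fun n =>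
  if ∃ k : Fin r, ((n + 1 : ℕ) : ZMod ((nthPrime k : ℕ) ^ 2)) = g (nthPrime k) then false
  else y (n - alphaGr r g (n + 1))

section FiniteEntropy

open Real

lemma negMulLog_add_le {a b : ℝ} (ha : 0 ≤ a) (hb : 0 ≤ b) :
    negMulLog (a + b) ≤ negMulLog a + negMulLog b := by
  rcases ha.eq_or_lt with rfl | ha
  · simp
  rcases hb.eq_or_lt with rfl | hb
  · simp
  have h1 : log a ≤ log (a + b) := log_le_log ha (by linarith)
  have h2 : log b ≤ log (a + b) := log_le_log hb (by linarith)
  simp only [negMulLog]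
  nlinarith

lemma negMulLog_sum_le {ι : Type*} (s : Finset ι) (p : ι → ℝ) (hp : ∀ i, 0 ≤ p i) :
    negMulLog (∑ i ∈ s, p i) ≤ ∑ i ∈ s, negMulLog (p i) := by
  induction s using Finset.induction_on with
  | empty => simp
  | insert i s hi ih =>
    rw [Finset.sum_insert hi, Finset.sum_insert hi]
    exact (negMulLog_add_le (hp i) (Finset.sum_nonneg fun j _ => hp j)).trans (by linarith)

/-- Entropy of a joint distribution is at most the sum of the entropies of its marginals,
in the homogeneous form that does not normalise the total mass. -/
lemma sum_negMulLog_add_le {β γ : Type*} [Fintype β] [Fintype γ] (q : β → γ → ℝ)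
    (hq : ∀ a b, 0 ≤ q a b) :
    ∑ a, ∑ b, negMulLog (q a b) + negMulLog (∑ a, ∑ b, q a b) ≤
      ∑ a, negMulLog (∑ b, q a b) + ∑ b, negMulLog (∑ a, q a b) := by
  set r : β → ℝ := fun a => ∑ b, q a b with hr
  set s : γ → ℝ := fun b => ∑ a, q a b with hs
  set t : ℝ := ∑ a, ∑ b, q a b with ht
  have hst : ∑ b, s b = t := by rw [ht, Finset.sum_comm]
  have hqr : ∀ a b, q a b ≤ r a := fun a b =>
    Finset.single_le_sum (f := q a) (fun j _ => hq a j) (Finset.mem_univ b)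
  have hqs : ∀ a b, q a b ≤ s b := fun a b =>
    Finset.single_le_sum (f := fun a => q a b) (fun j _ => hq j b) (Finset.mem_univ a)
  have hr0 : ∀ a, 0 ≤ r a := fun a => Finset.sum_nonneg fun b _ => hq a b
  have hs0 : ∀ b, 0 ≤ s b := fun b => Finset.sum_nonneg fun a _ => hq a b
  have hrt : ∀ a, r a ≤ t := fun a =>
    Finset.single_le_sum (f := r) (fun j _ => hr0 j) (Finset.mem_univ a)
  have ht0 : 0 ≤ t := Finset.sum_nonneg fun a _ => hr0 a
  have key : ∀ a b, negMulLog (q a b) + q a b * log (r a) + q a b * log (s b)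
      - q a b * log t ≤ r a * s b / t - q a b := by
    intro a b
    rcases (hq a b).eq_or_lt with h | h
    · rw [← h]
      simpa using div_nonneg (mul_nonneg (hr0 a) (hs0 b)) ht0
    · have h1 := h.trans_le (hqr a b)
      have h2 := h.trans_le (hqs a b)
      have h3 := h1.trans_le (hrt a)
      have h4 : 0 < r a * s b / (q a b * t) := by positivity
      have h5 := log_le_sub_one_of_pos h4
      rw [log_div (by positivity) (by positivity), log_mul h1.ne' h2.ne',
        log_mul h.ne' h3.ne'] at h5
      have h6 := mul_le_mul_of_nonneg_left h5 h.le
      have h7 : q a b * (r a * s b / (q a b * t) - 1) = r a * s b / t - q a b := by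
        field_simp
      rw [h7] at h6
      simp only [negMulLog]
      linarith
  have hsum := Finset.sum_le_sum fun a (_ : a ∈ Finset.univ) =>
    Finset.sum_le_sum fun b (_ : b ∈ Finset.univ) => key a b
  have e1 : ∑ a, ∑ b, q a b * log (r a) = - ∑ a, negMulLog (r a) := by
    rw [← Finset.sum_neg_distrib]
    refine Finset.sum_congr rfl fun a _ => ?_
    rw [← Finset.sum_mul]; simp [negMulLog, hr]
  have e2 : ∑ a, ∑ b, q a b * log (s b) = - ∑ b, negMulLog (s b) := by
    rw [Finset.sum_comm, ← Finset.sum_neg_distrib]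
    refine Finset.sum_congr rfl fun a _ => ?_
    rw [← Finset.sum_mul]; simp [negMulLog, hs]
  have e3 : ∑ a, ∑ b, q a b * log t = - negMulLog t := by
    simp only [← Finset.sum_mul]; simp [negMulLog, ht]
  have e4 : ∑ a, ∑ b, r a * s b / t = t := by
    simp only [← Finset.sum_div, ← Finset.mul_sum, hst, ← Finset.sum_mul]
    rcases ht0.eq_or_lt with h | h
    · simp [← h]
    · change t * t / t = t
      field_simp
  simp only [Finset.sum_add_distrib, Finset.sum_sub_distrib] at hsum
  rw [e1, e2, e3, e4] at hsum
  linarith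

variable {α β γ δ : Type*} [MeasurableSpace α]

lemma partH_eq_sum_real [Fintype β] (μ : Measure α) (f : α → β) :
    partH μ f = ∑ b, negMulLog (μ.real (f ⁻¹' {b})) := rfl

lemma partH_nonneg [Fintype β] (μ : Measure α) [IsProbabilityMeasure μ] (f : α → β) :
    0 ≤ partH μ f :=
  Finset.sum_nonneg fun _ _ => negMulLog_nonneg measureReal_nonneg measureReal_le_one

lemma partH_comp [Fintype γ] [MeasurableSpace β] [MeasurableSpace γ] [MeasurableSingletonClass γ]
    (μ : Measure α) {q : α → β} (hq : Measurable q) {f : β → γ} (hf : Measurable f) :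
    partH μ (f ∘ q) = partH (μ.map q) f := by
  refine Finset.sum_congr rfl fun c _ => ?_
  rw [Measure.map_apply hq (hf (measurableSet_singleton c)), preimage_comp]

lemma partH_congr_ae [Fintype β] {μ : Measure α} {f g : α → β} (h : f =ᵐ[μ] g) :
    partH μ f = partH μ g := by
  refine Finset.sum_congr rfl fun c _ => ?_
  rw [measure_congr (h.preimage {c})]

variable [Fintype β] [MeasurableSpace β] [MeasurableSingletonClass β]

lemma measureReal_preimage_eq_sum (μ : Measure α) [IsFiniteMeasure μ] {f : α → β}
    (hf : Measurable f) {B : Set α} (hB : MeasurableSet B) :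
    μ.real B = ∑ b, μ.real (f ⁻¹' {b} ∩ B) := by
  rw [← measureReal_biUnion_finset]
  · congr 1
    ext x
    simp
  · intro a _ b _ hab
    exact Disjoint.mono inter_subset_left inter_subset_left
      (Disjoint.preimage f (by simpa using hab))
  · exact fun b _ => (hf (measurableSet_singleton b)).inter hB

/-- Entropy decreases under coarsening of partitions. -/
lemma partH_le_of_determines [Fintype γ] (μ : Measure α) [IsProbabilityMeasure μ] {f : α → β}
    (hf : Measurable f) {g : α → γ} (h : ∀ x y, f x = f y → g x = g y) :
    partH μ g ≤ partH μ f := by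
  have : Nonempty α := nonempty_of_isProbabilityMeasure μ
  have : Nonempty γ := ‹Nonempty α›.map g
  obtain ⟨φ, hφ⟩ := (Function.factorsThrough_iff (f := f) g).1 (fun x y hxy => h x y hxy)
  have e : ∀ c, μ.real (g ⁻¹' {c}) = ∑ b with φ b = c, μ.real (f ⁻¹' {b}) := by
    intro c
    rw [← measureReal_biUnion_finset]
    · congr 1
      ext x
      simp [hφ]
    · intro a _ b _ hab
      exact Disjoint.preimage f (by simpa using hab)
    · exact fun b _ => hf (measurableSet_singleton b)
  rw [partH_eq_sum_real, partH_eq_sum_real, ← Finset.sum_fiberwise Finset.univ φ]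
  refine Finset.sum_le_sum fun c _ => ?_
  rw [e]
  exact negMulLog_sum_le _ _ fun _ => measureReal_nonneg

variable [Fintype γ] [MeasurableSpace γ] [MeasurableSingletonClass γ]
variable [Fintype δ] [MeasurableSpace δ] [MeasurableSingletonClass δ]

/-- Submodularity of entropy. -/
lemma partH_submodular (μ : Measure α) [IsProbabilityMeasure μ] {f : α → β} {g : α → γ}
    {h : α → δ} (hf : Measurable f) (hg : Measurable g) (hh : Measurable h) :
    partH μ (fun x => (f x, g x, h x)) + partH μ h ≤
      partH μ (fun x => (f x, h x)) + partH μ (fun x => (g x, h x)) := by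
  have hsf := fun b => hf (measurableSet_singleton b)
  have hsg := fun b => hg (measurableSet_singleton b)
  have hsh := fun b => hh (measurableSet_singleton b)
  set p : β → γ → δ → ℝ := fun a b c => μ.real (f ⁻¹' {a} ∩ (g ⁻¹' {b} ∩ h ⁻¹' {c})) with hp
  have e0 : ∀ a b c, μ.real ((fun x => (f x, g x, h x)) ⁻¹' {(a, b, c)}) = p a b c := by
    intro a b c
    rw [hp]
    congr 1
    ext x
    simp
  have e1 : ∀ a c, μ.real ((fun x => (f x, h x)) ⁻¹' {(a, c)}) = ∑ b, p a b c := by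
    intro a c
    rw [measureReal_preimage_eq_sum μ hg ((hf.prodMk hh) (measurableSet_singleton (a, c)))]
    refine Finset.sum_congr rfl fun b _ => ?_
    rw [hp]
    congr 1
    ext x
    simp only [mem_inter_iff, mem_preimage, mem_singleton_iff, Prod.mk.injEq]
    tauto
  have e2 : ∀ b c, μ.real ((fun x => (g x, h x)) ⁻¹' {(b, c)}) = ∑ a, p a b c := by
    intro b c
    rw [measureReal_preimage_eq_sum μ hf ((hg.prodMk hh) (measurableSet_singleton (b, c)))]
    refine Finset.sum_congr rfl fun b _ => ?_
    rw [hp]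
    congr 1
    ext x
    simp
  have e3 : ∀ c, μ.real (h ⁻¹' {c}) = ∑ a, ∑ b, p a b c := by
    intro c
    rw [measureReal_preimage_eq_sum μ hf (hsh c)]
    refine Finset.sum_congr rfl fun a _ => ?_
    rw [measureReal_preimage_eq_sum μ hg ((hsf a).inter (hsh c))]
    refine Finset.sum_congr rfl fun b _ => ?_
    rw [hp]
    congr 1
    ext x
    simp only [mem_inter_iff, mem_preimage, mem_singleton_iff]
    tauto
  have key := Finset.sum_le_sum fun c (_ : c ∈ (Finset.univ : Finset δ)) =>
    sum_negMulLog_add_le (fun a b => p a b c) (fun _ _ => measureReal_nonneg)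
  simp only [Finset.sum_add_distrib] at key
  simp only [partH_eq_sum_real, Fintype.sum_prod_type, e0, e1, e2, e3]
  calc _ = (∑ c, ∑ a, ∑ b, negMulLog (p a b c)) + ∑ c, negMulLog (∑ a, ∑ b, p a b c) := by
        congr 1
        rw [Finset.sum_comm]
        refine (Finset.sum_congr rfl fun b _ => Finset.sum_comm).trans ?_
        rw [Finset.sum_comm]
        exact Finset.sum_congr rfl fun c _ => Finset.sum_comm
    _ ≤ _ := key
    _ = _ := by
        congr 1
        · exact Finset.sum_comm
        · exact Finset.sum_comm

lemma partH_const (μ : Measure α) [IsProbabilityMeasure μ] : partH μ (fun _ => ()) = 0 := by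
  simp [partH_eq_sum_real]

lemma partH_prod_le (μ : Measure α) [IsProbabilityMeasure μ] {f : α → β} {g : α → γ}
    (hf : Measurable f) (hg : Measurable g) :
    partH μ (fun x => (f x, g x)) ≤ partH μ f + partH μ g := by
  have h1 := partH_submodular μ hf hg (measurable_const (a := ()))
  have h2 : partH μ (fun x => (f x, g x)) ≤ partH μ (fun x => (f x, g x, ())) :=
    partH_le_of_determines μ (by fun_prop) (by simp)
  have h3 : partH μ (fun x => (f x, ())) ≤ partH μ f :=
    partH_le_of_determines μ hf (by simp)
  have h4 : partH μ (fun x => (g x, ())) ≤ partH μ g :=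
    partH_le_of_determines μ hg (by simp)
  rw [partH_const] at h1
  linarith

end FiniteEntropy

section ProcessEntropy

open Real (negMulLog)

lemma le_of_forall_nat_mul_le {a b C : ℝ} (h : ∀ k : ℕ, k * a ≤ C + k * b) : a ≤ b := by
  by_contra! hab
  obtain ⟨k, hk⟩ := exists_nat_gt (C / (a - b))
  rw [div_lt_iff₀ (by linarith)] at hk
  linarith [h k]

/-- The first `n` symbols of the itinerary of a point under `T`, observed through `f`. -/
def word {α β : Type*} (T : α → α) (f : α → β) (n : ℕ) (x : α) : Fin n → β :=
  fun i => f (T^[i] x)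

lemma word_succ_ext {α β : Type*} {T : α → α} {f : α → β} {n : ℕ} {x y : α}
    (h : word T f n x = word T f n y) (h' : f (T^[n] x) = f (T^[n] y)) :
    word T f (n + 1) x = word T f (n + 1) y := by
  funext i
  refine Fin.lastCases ?_ (fun i => ?_) i
  · simpa [word] using h'
  · simpa [word] using congrFun h i

variable {α β γ : Type*} [MeasurableSpace α]

lemma measurable_word [MeasurableSpace β] {T : α → α} (hT : Measurable T) {f : α → β}
    (hf : Measurable f) (n : ℕ) : Measurable (word T f n) :=
  measurable_pi_lambda _ fun i => hf.comp (hT.iterate i)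

/-- Two functions into `Fin k` that agree outside a small set have small conditional entropy. -/
lemma exists_partH_prod_le_add (k : ℕ) {ε : ℝ} (hε : 0 < ε) (μ : Measure α)
    [IsProbabilityMeasure μ] :
    ∃ δ > 0, ∀ f g : α → Fin k, Measurable f → Measurable g → μ.real {x | f x ≠ g x} < δ →
      partH μ (fun x => (f x, g x)) ≤ partH μ g + ε := by
  set ε' : ℝ := ε / (k * k + 1) with hε'
  have hε'0 : 0 < ε' := by positivity
  have huc := isCompact_Icc.uniformContinuousOn_of_continuous
    (Real.continuous_negMulLog.continuousOn (s := Icc (0 : ℝ) 1))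
  obtain ⟨δ, hδ, hd⟩ := Metric.uniformContinuousOn_iff.1 huc ε' hε'0
  refine ⟨δ, hδ, fun f g hf hg hfg => ?_⟩
  have hmem : ∀ s, μ.real s ∈ Icc (0 : ℝ) 1 := fun s => ⟨measureReal_nonneg, measureReal_le_one⟩
  have hterm : ∀ a b : Fin k, negMulLog (μ.real ((fun x => (f x, g x)) ⁻¹' {(a, b)})) ≤
      (if a = b then negMulLog (μ.real (g ⁻¹' {b})) else 0) + ε' := by
    intro a b
    split_ifs with hab
    · subst hab
      have hsub : (fun x => (f x, g x)) ⁻¹' {(a, a)} ⊆ g ⁻¹' {a} := fun x hx => by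
        simp at hx ⊢; exact hx.2
      have h1 : μ.real (g ⁻¹' {a}) ≤
          μ.real ((fun x => (f x, g x)) ⁻¹' {(a, a)}) + μ.real {x | f x ≠ g x} := by
        refine (measureReal_mono (fun x hx => ?_)).trans (measureReal_union_le _ _)
        simp only [mem_preimage, mem_singleton_iff, mem_union, Prod.mk.injEq, mem_ofPred_eq] at hx ⊢
        by_cases h : f x = g x
        · exact Or.inl ⟨h.trans hx, hx⟩
        · exact Or.inr h
      have h2 := measureReal_mono (μ := μ) hsub
      have h3 := hd _ (hmem ((fun x => (f x, g x)) ⁻¹' {(a, a)})) _ (hmem (g ⁻¹' {a}))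
        (by rw [Real.dist_eq, abs_lt]; constructor <;> linarith)
      rw [Real.dist_eq, abs_lt] at h3
      linarith [h3.2]
    · have h1 : μ.real ((fun x => (f x, g x)) ⁻¹' {(a, b)}) ≤ μ.real {x | f x ≠ g x} := by
        refine measureReal_mono fun x hx => ?_
        simp only [mem_preimage, mem_singleton_iff, Prod.mk.injEq, mem_ofPred_eq] at hx ⊢
        rw [hx.1, hx.2]; exact hab
      have h3 := hd _ (hmem ((fun x => (f x, g x)) ⁻¹' {(a, b)})) 0 (by simp)
        (by rw [Real.dist_eq, abs_lt]
            constructor <;> linarith [(hmem ((fun x => (f x, g x)) ⁻¹' {(a, b)})).1])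
      rw [Real.dist_eq, abs_lt, Real.negMulLog_zero] at h3
      linarith [h3.2]
  rw [partH_eq_sum_real, Fintype.sum_prod_type, partH_eq_sum_real]
  calc _ ≤ ∑ a : Fin k, ∑ b : Fin k,
        ((if a = b then negMulLog (μ.real (g ⁻¹' {b})) else 0) + ε') :=
        Finset.sum_le_sum fun a _ => Finset.sum_le_sum fun b _ => hterm a b
    _ = ∑ b, negMulLog (μ.real (g ⁻¹' {b})) + k * k * ε' := by
        simp only [Finset.sum_add_distrib, Finset.sum_ite_eq, Finset.mem_univ, if_true,
          Finset.sum_const, Finset.card_univ, Fintype.card_fin, nsmul_eq_mul]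
        ring
    _ ≤ _ := by
        have : k * k * ε' ≤ ε := by
          rw [hε', mul_div_assoc', div_le_iff₀ (by positivity)]
          nlinarith
        linarith

variable {μ : Measure α} {T : α → α}
lemma partH_word_zero_le [IsProbabilityMeasure μ] [Fintype β] (T : α → α) (f : α → β) :
    partH μ (word T f 0) ≤ 0 := by
  refine (partH_le_of_determines μ (f := fun _ => ()) measurable_const fun x y _ => ?_).trans_eq
    (partH_const μ)
  funext i
  exact absurd i.2 (by simp)

variable [Fintype β] [MeasurableSpace β] [MeasurableSingletonClass β]
variable [Fintype γ] [MeasurableSpace γ] [MeasurableSingletonClass γ]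

lemma partH_comp_iterate (hT : MeasurePreserving T μ μ) {f : α → β} (hf : Measurable f) (n : ℕ) :
    partH μ (fun x => f (T^[n] x)) = partH μ f := by
  have h := hT.iterate n
  conv_rhs => rw [← h.map_eq]
  exact partH_comp μ h.measurable hf

lemma partH_word_add_le_comp [IsProbabilityMeasure μ]
    (hT : Measurable T) {f : α → β} (hf : Measurable f) (a b : ℕ) :
    partH μ (word T f (a + b)) ≤ partH μ (word T f a) + partH μ (word T f b ∘ T^[a]) := by
  have hma := measurable_word hT hf a
  have hmb' := (measurable_word hT hf b).comp (hT.iterate a)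
  have h1 : partH μ (word T f (a + b)) ≤
      partH μ (fun x => (word T f a x, (word T f b ∘ T^[a]) x)) := by
    refine partH_le_of_determines μ (hma.prodMk hmb') fun x y hxy => ?_
    simp only [Prod.mk.injEq] at hxy
    funext i
    refine Fin.addCases (fun i => ?_) (fun i => ?_) i
    · exact congrFun hxy.1 i
    · have := congrFun hxy.2 i
      simp only [word, Function.comp, ← Function.iterate_add_apply] at this ⊢
      rw [Fin.val_natAdd, add_comm]
      exact this
  exact h1.trans (partH_prod_le μ hma hmb')

lemma partH_word_add_le [IsProbabilityMeasure μ]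
    (hT : MeasurePreserving T μ μ) {f : α → β} (hf : Measurable f)
    (a b : ℕ) :
    partH μ (word T f (a + b)) ≤ partH μ (word T f a) + partH μ (word T f b) :=
  (partH_word_add_le_comp hT.measurable hf a b).trans_eq
    (congrArg _ (partH_comp_iterate hT (measurable_word hT.measurable hf b) a))

lemma partH_word_mul_le [IsProbabilityMeasure μ]
    (hT : MeasurePreserving T μ μ) {f : α → β} (hf : Measurable f)
    (k n : ℕ) : partH μ (word T f (k * n)) ≤ k * partH μ (word T f n) := by
  induction k with
  | zero => 
    rw [zero_mul, Nat.cast_zero, zero_mul]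
    exact partH_word_zero_le T f
  | succ k ih =>
    rw [Nat.succ_mul]
    push_cast
    linarith [partH_word_add_le hT hf (k * n) n]

lemma partH_word_prod_le [IsProbabilityMeasure μ]
    (hT : MeasurePreserving T μ μ) {f : α → β} (hf : Measurable f)
    {g : α → γ} (hg : Measurable g) (n : ℕ) :
    partH μ (fun x => (word T f n x, word T g n x)) ≤ partH μ (word T g n) +
      n * (partH μ (fun x => (f x, g x)) - partH μ g) := by
  induction n with
  | zero =>
    have : partH μ (fun x => (word T f 0 x, word T g 0 x)) ≤ partH μ (word T g 0) :=
      partH_le_of_determines μ (measurable_word hT.measurable hg 0) fun x y _ =>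
        Subsingleton.elim _ _
    simpa using this
  | succ n ih =>
    have hA := measurable_word hT.measurable hf n
    have hB := measurable_word hT.measurable hg n
    have hc : Measurable fun x => f (T^[n] x) := hf.comp (hT.measurable.iterate n)
    have hd : Measurable fun x => g (T^[n] x) := hg.comp (hT.measurable.iterate n)
    have s1 := partH_submodular μ (hA.prodMk hB) hc hd
    have s2 := partH_submodular μ hA hd hB
    have i1 : partH μ (fun x => (f (T^[n] x), g (T^[n] x))) = partH μ (fun x => (f x, g x)) :=
      partH_comp_iterate hT (hf.prodMk hg) n
    have i2 : partH μ (fun x => g (T^[n] x)) = partH μ g := partH_comp_iterate hT hg n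
    have d1 : partH μ (fun x => (word T f (n + 1) x, word T g (n + 1) x)) ≤
        partH μ (fun x => ((word T f n x, word T g n x), f (T^[n] x), g (T^[n] x))) := by
      refine partH_le_of_determines μ ((hA.prodMk hB).prodMk (hc.prodMk hd)) fun x y h => ?_
      simp only [Prod.mk.injEq] at h
      exact Prod.ext (word_succ_ext h.1.1 h.2.1) (word_succ_ext h.1.2 h.2.2)
    have d2 : partH μ (fun x => ((word T f n x, word T g n x), g (T^[n] x))) ≤
        partH μ (fun x => (word T f n x, g (T^[n] x), word T g n x)) := by
      refine partH_le_of_determines μ (hA.prodMk (hd.prodMk hB)) fun x y h => ?_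
      simp only [Prod.mk.injEq] at h ⊢
      tauto
    have d3 : partH μ (fun x => (g (T^[n] x), word T g n x)) ≤ partH μ (word T g (n + 1)) := by
      refine partH_le_of_determines μ (measurable_word hT.measurable hg (n + 1)) fun x y h => ?_
      refine Prod.ext ?_ ?_
      · simpa [word] using congrFun h (Fin.last n)
      · funext i
        simpa [word] using congrFun h i.castSucc
    push_cast
    linarith

lemma procH_eq_iInf_word {k : ℕ} (μ : Measure α) (T : α → α) (f : α → Fin k) :
    procH μ T f = ⨅ n : ℕ, partH μ (word T f (n + 1)) / (n + 1) := rfl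

lemma procH_le_partH_word [IsProbabilityMeasure μ] {k : ℕ} (f : α → Fin k) (n : ℕ) :
    procH μ T f ≤ partH μ (word T f (n + 1)) / (n + 1) := by
  refine ciInf_le (f := fun n : ℕ => partH μ (word T f (n + 1)) / (n + 1)) ⟨0, ?_⟩ n
  rintro _ ⟨n, rfl⟩
  exact div_nonneg (partH_nonneg μ _) (by positivity)

lemma mul_procH_le_partH_word [IsProbabilityMeasure μ] {k : ℕ} (f : α → Fin k) (n : ℕ) :
    n * procH μ T f ≤ partH μ (word T f n) := by
  cases n with
  | zero => simpa using partH_nonneg μ _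
  | succ n =>
    have := procH_le_partH_word (μ := μ) (T := T) f n
    rw [le_div_iff₀ (by positivity)] at this
    push_cast
    linarith

lemma le_procH {k : ℕ} {f : α → Fin k} {c : ℝ}
    (h : ∀ n : ℕ, (n : ℝ) * c ≤ partH μ (word T f n)) : c ≤ procH μ T f := by
  refine le_ciInf fun n => ?_
  rw [le_div_iff₀ (by positivity)]
  have := h (n + 1)
  push_cast at this
  exact (mul_comm c _).trans_le this

lemma procH_le_add [IsProbabilityMeasure μ]
    {k l : ℕ} (hT : MeasurePreserving T μ μ) {f : α → Fin k} (hf : Measurable f)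
    {g : α → Fin l} (hg : Measurable g) :
    procH μ T f ≤ procH μ T g + (partH μ (fun x => (f x, g x)) - partH μ g) := by
  rw [← sub_le_iff_le_add]
  refine le_procH fun n => ?_
  have h1 := mul_procH_le_partH_word (μ := μ) (T := T) f n
  have h2 := partH_word_prod_le hT hf hg n
  have h3 : partH μ (word T f n) ≤ partH μ (fun x => (word T f n x, word T g n x)) :=
    partH_le_of_determines μ ((measurable_word hT.measurable hf n).prodMk
      (measurable_word hT.measurable hg n)) fun x y h => (Prod.mk.injEq _ _ _ _ ▸ h).1
  linarith

lemma procH_le_of_partH_word_le [IsProbabilityMeasure μ]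
    {k l : ℕ} (hT : MeasurePreserving T μ μ) {f : α → Fin k}
    {g : α → Fin l} (hg : Measurable g) {C : ℝ} {r : ℕ}
    (h : ∀ n, partH μ (word T f n) ≤ C + partH μ (word T g (n + r))) :
    procH μ T f ≤ procH μ T g := by
  refine le_procH fun n => ?_
  refine le_of_forall_nat_mul_le (C := C + partH μ (word T g r)) fun k => ?_
  have h1 := mul_procH_le_partH_word (μ := μ) (T := T) f (k * n)
  have h2 := partH_word_add_le hT hg (k * n) r
  have h3 := partH_word_mul_le hT hg k n
  have h4 := h (k * n)
  push_cast at h1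
  linarith

lemma procH_comp {κ : Type*} [MeasurableSpace κ] {k : ℕ} {q : α → κ} {ν : Measure κ}
    (hq : MeasurePreserving q μ ν) {U : κ → κ} (hU : Measurable U)
    (hqU : ∀ x, q (T x) = U (q x)) {f : κ → Fin k} (hf : Measurable f) :
    procH μ T (f ∘ q) = procH ν U f := by
  rw [procH_eq_iInf_word, procH_eq_iInf_word]
  congr 1
  funext n
  rw [← hq.map_eq, ← partH_comp μ hq.measurable (measurable_word hU hf _)]
  congr 2
  funext x i
  simp only [word, Function.comp]
  rw [Function.Semiconj.iterate_right (f := q) hqU i x]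

lemma procH_congr_ae {k : ℕ} (hT : MeasurePreserving T μ μ) {f g : α → Fin k} (h : f =ᵐ[μ] g) :
    procH μ T f = procH μ T g := by
  rw [procH_eq_iInf_word, procH_eq_iInf_word]
  congr 1
  funext n
  congr 1
  refine partH_congr_ae ?_
  have : ∀ i : Fin (n + 1), ∀ᵐ x ∂μ, f (T^[i] x) = g (T^[i] x) := fun i =>
    (hT.iterate i).quasiMeasurePreserving.ae h
  filter_upwards [ae_all_iff.2 this] with x hx
  funext i
  exact hx i

lemma le_ksEntropy {k : ℕ} (μ : Measure α) (T : α → α) {f : α → Fin k} (hf : Measurable f) :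
    ((procH μ T f : ℝ) : EReal) ≤ ksEntropy μ T :=
  le_iSup_of_le k (le_iSup_of_le f (le_iSup_of_le hf le_rfl))

lemma ksEntropy_le {c : EReal}
    (h : ∀ (k : ℕ) (f : α → Fin k), Measurable f → ((procH μ T f : ℝ) : EReal) ≤ c) :
    ksEntropy μ T ≤ c :=
  iSup_le fun k => iSup_le fun f => iSup_le fun hf => h k f hf

end ProcessEntropy

section Cylinders

/-- The finite quotient of `G` seen by the primes in `S`. -/
abbrev GFin (S : Finset Nat.Primes) : Type := ∀ p : S, ZMod (((p : Nat.Primes) : ℕ) ^ 2)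

/-- The product of the rotation `T1` and the shift. -/
def rotShift : G × Omega2 → G × Omega2 := Prod.map T1 shift

/-- The zeroth symbol, as an element of `Fin 2`. -/
def firstBit (x : Omega2) : Fin 2 := if x 0 then 1 else 0

lemma measurable_T1 : Measurable T1 :=
  measurable_pi_lambda _ fun p =>
    (measurable_of_countable fun a : ZMod ((p : ℕ) ^ 2) => a - 1).comp (measurable_pi_apply p)

lemma measurable_shift : Measurable shift :=
  measurable_pi_lambda _ fun _ => measurable_pi_apply _

lemma measurable_rotShift : Measurable rotShift := measurable_T1.prodMap measurable_shift

lemma measurable_firstBit : Measurable firstBit :=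
  (measurable_of_countable fun b : Bool => (if b then 1 else 0 : Fin 2)).comp
    (measurable_pi_apply 0)

lemma T1_iterate_apply (i : ℕ) (g : G) (p : Nat.Primes) : T1^[i] g p = g p - i := by
  induction i generalizing g with
  | zero => simp
  | succ i ih =>
    rw [Function.iterate_succ_apply, ih]
    simp only [T1]
    push_cast
    ring

lemma shift_iterate_apply (i : ℕ) (x : Omega2) (j : ℕ) : shift^[i] x j = x (j + i) := by
  induction i generalizing x with
  | zero => simp
  | succ i ih =>
    rw [Function.iterate_succ_apply, ih]
    simp only [shift]
    ring_nf

lemma rotShift_iterate (i : ℕ) (z : G × Omega2) :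
    rotShift^[i] z = (T1^[i] z.1, shift^[i] z.2) := by
  rw [rotShift, Prod.map_iterate]
  rfl

lemma firstBit_injective {x y : Omega2} (h : firstBit x = firstBit y) : x 0 = y 0 := by
  unfold firstBit at h
  cases hx : x 0 <;> cases hy : y 0 <;> simp_all

/-- `B` depends only on the coordinates of the group in `S` and the first `r` symbols. -/
def DependsOnFinite (S : Finset Nat.Primes) (r : ℕ) {κ : Type*} (f : G × Omega2 → κ) : Prop :=
  ∀ z z' : G × Omega2, (∀ p ∈ S, z.1 p = z'.1 p) → (∀ i < r, z.2 i = z'.2 i) → f z = f z'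

lemma DependsOnFinite.mono {S S' : Finset Nat.Primes} {r r' : ℕ} {κ : Type*}
    {f : G × Omega2 → κ} (h : DependsOnFinite S r f) (hS : S ⊆ S') (hr : r ≤ r') :
    DependsOnFinite S' r' f :=
  fun z z' h1 h2 => h z z' (fun p hp => h1 p (hS hp)) fun i hi => h2 i (hi.trans_le hr)

lemma DependsOnFinite.measurable {S : Finset Nat.Primes} {r : ℕ} {κ : Type*}
    [MeasurableSpace κ] {f : G × Omega2 → κ} (h : DependsOnFinite S r f) : Measurable f := by
  let F : G × Omega2 → GFin S × (Fin r → Bool) := fun z => (fun p => z.1 p, fun i => z.2 i)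
  have hF : Measurable F := by fun_prop
  have : Nonempty κ := ⟨f (0, fun _ => false)⟩
  obtain ⟨φ, hφ⟩ := (Function.factorsThrough_iff (f := F) f).1 fun z z' hz => by
    simp only [F, Prod.mk.injEq] at hz
    exact h z z' (fun p hp => congrFun hz.1 ⟨p, hp⟩) fun i hi => congrFun hz.2 ⟨i, hi⟩
  rw [hφ]
  exact (measurable_of_finite φ).comp hF

/-- The sets depending on finitely many coordinates. -/
def cylinderSets : Set (Set (G × Omega2)) :=
  {B | ∃ S r, DependsOnFinite S r (fun z => z ∈ B)}

lemma isSetRing_cylinderSets : IsSetRing cylinderSets where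
  empty_mem := ⟨∅, 0, fun _ _ _ _ => rfl⟩
  union_mem := by
    rintro s t ⟨S, r, h⟩ ⟨S', r', h'⟩
    refine ⟨S ∪ S', max r r', fun z z' h1 h2 => ?_⟩
    have e := h.mono Finset.subset_union_left (le_max_left r r') z z' h1 h2
    have e' := h'.mono Finset.subset_union_right (le_max_right r r') z z' h1 h2
    simp only [mem_union, e, e']
  sdiff_mem := by
    rintro s t ⟨S, r, h⟩ ⟨S', r', h'⟩
    refine ⟨S ∪ S', max r r', fun z z' h1 h2 => ?_⟩
    have e := h.mono Finset.subset_union_left (le_max_left r r') z z' h1 h2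
    have e' := h'.mono Finset.subset_union_right (le_max_right r r') z z' h1 h2
    simp only [Set.mem_sdiff, e, e']

lemma measurableSet_of_mem_cylinderSets {B : Set (G × Omega2)} (hB : B ∈ cylinderSets) :
    MeasurableSet B := by
  obtain ⟨S, r, h⟩ := hB
  exact measurableSet_setOfPred.2 h.measurable

lemma generateFrom_cylinderSets :
    (inferInstance : MeasurableSpace (G × Omega2)) =
      MeasurableSpace.generateFrom cylinderSets := by
  refine le_antisymm ?_ (MeasurableSpace.generateFrom_le fun B hB =>
    measurableSet_of_mem_cylinderSets hB)
  refine sup_le ?_ ?_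
  · rw [← measurable_iff_comap_le]
    refine @measurable_pi_lambda _ _ _ (_) _ _ fun p => ?_
    intro U _
    exact MeasurableSpace.measurableSet_generateFrom
      ⟨{p}, 0, fun z z' h1 _ => by simp [h1 p (by simp)]⟩
  · rw [← measurable_iff_comap_le]
    refine @measurable_pi_lambda _ _ _ (_) _ _ fun i => ?_
    intro U _
    exact MeasurableSpace.measurableSet_generateFrom
      ⟨∅, i + 1, fun z z' _ h2 => by simp [h2 i (by simp)]⟩

lemma procH_le_of_dependsOnFinite {μ : Measure (G × Omega2)} [IsProbabilityMeasure μ]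
    (hμ : MeasurePreserving rotShift μ μ) {k : ℕ} {f : G × Omega2 → Fin k}
    {S : Finset Nat.Primes} {r : ℕ} (hf : DependsOnFinite S r f) :
    procH μ rotShift f ≤ procH μ rotShift (firstBit ∘ Prod.snd) := by
  have hX : Measurable (firstBit ∘ Prod.snd : G × Omega2 → Fin 2) :=
    measurable_firstBit.comp measurable_snd
  have hR : Measurable fun z : G × Omega2 => (fun p => z.1 p : GFin S) := by fun_prop
  refine procH_le_of_partH_word_le hμ hX
    (C := partH μ fun z : G × Omega2 => (fun p => z.1 p : GFin S)) (r := r) fun n => ?_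
  refine le_trans ?_ (partH_prod_le μ hR (measurable_word measurable_rotShift hX (n + r)))
  refine partH_le_of_determines μ
    (hR.prodMk (measurable_word measurable_rotShift hX (n + r))) fun z z' h => ?_
  simp only [Prod.mk.injEq] at h
  funext i
  refine hf _ _ (fun p hp => ?_) fun j hj => ?_
  · have := congrFun h.1 ⟨p, hp⟩
    simp only [rotShift_iterate, T1_iterate_apply, this]
  · have := congrFun h.2 ⟨j + i, by omega⟩
    simp only [word, rotShift_iterate, Function.comp] at this
    simpa [rotShift_iterate, shift_iterate_apply] using firstBit_injective this

/-- The rotation contributes nothing to entropy: the observable reading off the first symbol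
carries the whole entropy of `T1 × σ`. -/
lemma ksEntropy_rotShift_le {μ : Measure (G × Omega2)} [IsProbabilityMeasure μ]
    (hμ : MeasurePreserving rotShift μ μ) :
    ksEntropy μ rotShift ≤ ((procH (μ.map Prod.snd) shift firstBit : ℝ) : EReal) := by
  have hfac : procH μ rotShift (firstBit ∘ Prod.snd) = procH (μ.map Prod.snd) shift firstBit :=
    procH_comp (measurable_snd.measurePreserving μ) measurable_shift (fun _ => rfl)
      measurable_firstBit
  rw [← hfac]
  refine ksEntropy_le fun k f hf => EReal.coe_le_coe_iff.2 ?_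
  refine le_of_forall_pos_le_add fun ε hε => ?_
  obtain ⟨δ, hδ, hclose⟩ := exists_partH_prod_le_add k hε μ
  have hη : 0 < δ / (k + 1) := by positivity
  have happrox : ∀ a : Fin k, ∃ t ∈ cylinderSets,
      μ (symmDiff t (f ⁻¹' {a})) < ENNReal.ofReal (δ / (k + 1)) := fun a =>
    exists_measure_symmDiff_lt_of_generateFrom_isSetRing isSetRing_cylinderSets
      ⟨{univ}, countable_singleton _, by
        rintro _ rfl; exact ⟨∅, 0, fun _ _ _ _ => rfl⟩, by simp⟩
      generateFrom_cylinderSets (hf (measurableSet_singleton a)) (ENNReal.ofReal_pos.2 hη)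
  choose t ht htμ using happrox
  choose S r hSr using ht
  let a₀ : Fin k := f (0, fun _ => false)
  let φ : (Fin k → Prop) → Fin k := fun P => if h : ∃ a, P a then h.choose else a₀
  let f' : G × Omega2 → Fin k := fun z => φ fun a => z ∈ t a
  have hf' : DependsOnFinite (Finset.univ.biUnion S) (Finset.univ.sup r) f' := by
    intro z z' h1 h2
    change φ _ = φ _
    congr 1
    funext a
    exact (hSr a).mono (Finset.subset_biUnion_of_mem S (Finset.mem_univ a))
      (Finset.le_sup (Finset.mem_univ a)) z z' h1 h2
  have hsub : {z | f z ≠ f' z} ⊆ ⋃ a ∈ (Finset.univ : Finset (Fin k)),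
      symmDiff (t a) (f ⁻¹' {a}) := by
    intro z hz
    by_contra hcon
    simp only [Finset.mem_univ, iUnion_true, mem_iUnion, not_exists, mem_symmDiff] at hcon
    have hiff : ∀ a, z ∈ t a ↔ f z = a := fun a => by
      have := hcon a
      simp only [mem_preimage, mem_singleton_iff] at this
      tauto
    have hex : ∃ a, z ∈ t a := ⟨f z, (hiff _).2 rfl⟩
    refine hz ((hiff _).1 ?_)
    have : f' z = hex.choose := dif_pos hex
    rw [this]
    exact hex.choose_spec
  have hlt : μ.real {z | f z ≠ f' z} < δ := by
    calc μ.real {z | f z ≠ f' z} ≤ ∑ a : Fin k, μ.real (symmDiff (t a) (f ⁻¹' {a})) :=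
          (measureReal_mono hsub (measure_ne_top _ _)).trans (measureReal_biUnion_finset_le _ _)
      _ ≤ ∑ _a : Fin k, δ / (k + 1) := by
          refine Finset.sum_le_sum fun a _ => ?_
          exact ENNReal.toReal_le_of_le_ofReal hη.le (htμ a).le
      _ = k * (δ / (k + 1)) := by simp
      _ < δ := by
          rw [mul_div_assoc', div_lt_iff₀ (by positivity)]
          nlinarith
  have h1 := procH_le_add hμ hf hf'.measurable
  have h2 := procH_le_of_dependsOnFinite hμ hf'
  have h3 := hclose f f' hf hf'.measurable hlt
  linarith

end Cylinders

section Rotation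

/-- The projection of `G` to the coordinates in `S`. -/
def resFin (S : Finset Nat.Primes) (g : G) : GFin S := fun p => g p

/-- Position `n` is not deleted by any of the classes of `c`. -/
def FreeFin {S : Finset Nat.Primes} (c : GFin S) (n : ℕ) : Prop :=
  ∀ p : S, ((n + 1 : ℕ) : ZMod (((p : Nat.Primes) : ℕ) ^ 2)) ≠ c p

/-- Position `n` is not deleted by any of the classes of `g`. -/
def Free (g : G) (n : ℕ) : Prop :=
  ¬ ∃ p : Nat.Primes, ((n + 1 : ℕ) : ZMod ((p : ℕ) ^ 2)) = g p

/-- The density of positions that are not deleted by the primes in `S`. -/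
def densFin (S : Finset Nat.Primes) : ℝ :=
  (Finset.univ.filter fun c : GFin S => FreeFin c 0).card / Fintype.card (GFin S)

lemma measurable_resFin (S : Finset Nat.Primes) : Measurable (resFin S) := by
  unfold resFin; fun_prop

lemma gfin_eq_of_sub_one {S : Finset Nat.Primes} {κ : Type*} {φ : GFin S → κ}
    (h : ∀ c, φ (c - 1) = φ c) (c c' : GFin S) : φ c = φ c' := by
  have hj : ∀ (j : ℕ) (c : GFin S), φ (c - j) = φ c := by
    intro j
    induction j with
    | zero => simp
    | succ j ih =>
      intro c
      rw [← h c, ← ih (c - 1)]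
      congr 1
      push_cast
      ring
  let a : Nat.Primes → ℕ := fun p => if hp : p ∈ S then (c ⟨p, hp⟩ - c' ⟨p, hp⟩).val else 0
  obtain ⟨j, hjS⟩ := Nat.chineseRemainderOfFinset a (fun p : Nat.Primes => (p : ℕ) ^ 2) S
    (fun p _ => pow_ne_zero 2 p.2.ne_zero) (fun p _ q _ hpq => by
      exact Nat.Coprime.pow 2 2 ((Nat.coprime_primes p.2 q.2).2 fun h => hpq (Subtype.ext h)))
  rw [← hj j c]
  congr 1
  funext p
  have h1 := (ZMod.natCast_eq_natCast_iff _ _ _).2 (hjS p p.2)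
  have h2 : (a p : ZMod (((p : Nat.Primes) : ℕ) ^ 2)) = c p - c' p := by
    simp only [a, p.2, dif_pos]
    exact ZMod.natCast_zmod_val _
  simp only [Pi.sub_apply, Pi.natCast_apply, h1, h2]
  ring

lemma freeFin_succ {S : Finset Nat.Primes} (c : GFin S) (n : ℕ) :
    FreeFin c (n + 1) ↔ FreeFin (c - 1) n := by
  unfold FreeFin
  refine forall_congr' fun p => not_congr ?_
  simp only [Pi.sub_apply, Pi.one_apply, eq_sub_iff_add_eq]
  push_cast
  rfl

lemma free_succ (g : G) (n : ℕ) : Free g (n + 1) ↔ Free (T1 g) n := by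
  unfold Free
  refine not_congr (exists_congr fun p => ?_)
  simp only [T1, eq_sub_iff_add_eq]
  push_cast
  rfl

lemma free_zero (g : G) : Free g 0 ↔ g ∈ G1ᶜ := by
  simp [Free, G1, eq_comm]

lemma free_add (g : G) (n k : ℕ) : Free g (n + k) ↔ Free (T1^[k] g) n := by
  induction k generalizing g with
  | zero => rfl
  | succ k ih => rw [← add_assoc, free_succ, ih, Function.iterate_succ_apply]

lemma freeFin_resFin_zero (S : Finset Nat.Primes) (g : G) :
    FreeFin (resFin S g) 0 ↔ ∀ p ∈ S, g p ≠ 1 := by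
  simp only [FreeFin, resFin, zero_add, Nat.cast_one, Subtype.forall, ne_comm]

lemma card_freeFin (S : Finset Nat.Primes) (n : ℕ) :
    ((Finset.univ.filter fun c : GFin S => FreeFin c n).card : ℝ) =
      Fintype.card (GFin S) * densFin S := by
  have h0 : ((Finset.univ.filter fun c : GFin S => FreeFin c 0).card : ℝ) =
      Fintype.card (GFin S) * densFin S := by
    have : (Fintype.card (GFin S) : ℝ) ≠ 0 := Nat.cast_ne_zero.2 Fintype.card_ne_zero
    rw [densFin]
    field_simp
  rw [← h0]
  induction n with
  | zero => rfl
  | succ n ih =>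
    rw [← ih]
    congr 1
    refine Finset.card_equiv (Equiv.subRight 1) fun c => ?_
    simp [freeFin_succ]

lemma measurableSet_G1 : MeasurableSet G1 := by
  have : G1 = ⋃ p : Nat.Primes, (fun g : G => g p) ⁻¹' {1} := by
    ext g
    simp [G1]
  rw [this]
  exact MeasurableSet.iUnion fun p => (measurable_pi_apply p) (measurableSet_singleton _)

lemma measurableSet_free (n : ℕ) : MeasurableSet {g | Free g n} := by
  have : {g | Free g n} = T1^[n] ⁻¹' G1ᶜ := by
    ext g
    have := free_add g 0 n
    rw [zero_add, free_zero] at this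
    exact this
  rw [this]
  exact (measurable_T1.iterate n) measurableSet_G1.compl

variable {π : Measure G} [IsProbabilityMeasure π]

lemma measureReal_resFin (hπ : MeasurePreserving T1 π π) (S : Finset Nat.Primes) (c : GFin S) :
    π.real (resFin S ⁻¹' {c}) = (Fintype.card (GFin S) : ℝ)⁻¹ := by
  have hinv : ∀ c : GFin S, π.real (resFin S ⁻¹' {c - 1}) = π.real (resFin S ⁻¹' {c}) := by
    intro c
    rw [← hπ.measureReal_preimage
      (measurable_resFin S (measurableSet_singleton _)).nullMeasurableSet]
    congr 1
    ext g
    simp only [mem_preimage, mem_singleton_iff]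
    rw [show resFin S (T1 g) = resFin S g - 1 from rfl, sub_left_inj]
  have hsum := measureReal_preimage_eq_sum π (measurable_resFin S) MeasurableSet.univ
  simp only [inter_univ] at hsum
  have hconst : ∑ c', π.real (resFin S ⁻¹' {c'}) =
      ∑ _c' : GFin S, π.real (resFin S ⁻¹' {c}) :=
    Finset.sum_congr rfl fun c' _ =>
      gfin_eq_of_sub_one (φ := fun c => π.real (resFin S ⁻¹' {c})) hinv c' c
  rw [hconst] at hsum
  simp only [probReal_univ, Finset.sum_const, Finset.card_univ, nsmul_eq_mul] at hsum
  exact eq_inv_of_mul_eq_one_right hsum.symm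

lemma measureReal_free_resFin (hπ : MeasurePreserving T1 π π) (S : Finset Nat.Primes) :
    π.real {g | FreeFin (resFin S g) 0} = densFin S := by
  have : {g | FreeFin (resFin S g) 0} =
      ⋃ c ∈ Finset.univ.filter fun c : GFin S => FreeFin c 0, resFin S ⁻¹' {c} := by
    ext g
    simp
  rw [this, measureReal_biUnion_finset]
  · rw [Finset.sum_congr rfl fun c _ => measureReal_resFin hπ S c]
    simp [densFin, div_eq_mul_inv]
  · intro a _ b _ hab
    exact Disjoint.preimage _ (by simpa using hab)
  · exact fun c _ => measurable_resFin S (measurableSet_singleton c)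

lemma exists_densFin_lt (hπ : MeasurePreserving T1 π π) {ε : ℝ} (hε : 0 < ε)
    (S₀ : Finset Nat.Primes) :
    ∃ S, S₀ ⊆ S ∧ densFin S < π.real G1ᶜ + ε := by
  have hanti : Antitone fun S : Finset Nat.Primes => {g : G | FreeFin (resFin S g) 0} := by
    intro S S' h g hg
    rw [mem_ofPred_eq, freeFin_resFin_zero] at hg ⊢
    exact fun p hp => hg p (h hp)
  have hinter : ⋂ S : Finset Nat.Primes, {g : G | FreeFin (resFin S g) 0} = G1ᶜ := by
    ext g
    simp only [mem_iInter, mem_ofPred_eq, freeFin_resFin_zero, G1, mem_compl_iff, not_exists]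
    exact ⟨fun h p => h {p} p (by simp), fun h S p _ => h p⟩
  have hmeas : ∀ S : Finset Nat.Primes, MeasurableSet {g : G | FreeFin (resFin S g) 0} :=
    fun S => measurable_resFin S (Set.toFinite {c | FreeFin c 0}).measurableSet
  have ht := tendsto_measure_iInter_atTop (μ := π)
    (fun S => (hmeas S).nullMeasurableSet) hanti ⟨∅, measure_ne_top _ _⟩
  rw [hinter] at ht
  have ht' := (ENNReal.tendsto_toReal (measure_ne_top π _)).comp ht
  have := ((ht'.eventually (gt_mem_nhds (lt_add_of_pos_right _ hε))).and
    (eventually_ge_atTop S₀)).exists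
  obtain ⟨S, hS, hS₀⟩ := this
  refine ⟨S, hS₀, ?_⟩
  rw [← measureReal_free_resFin hπ S]
  exact hS

lemma measure_coord_eq_one (hπ : MeasurePreserving T1 π π) (p : Nat.Primes) :
    π {g | g p = 1} = ENNReal.ofReal (1 / ((p : ℕ) : ℝ) ^ 2) := by
  have h := measureReal_resFin hπ {p} 1
  have hset : resFin {p} ⁻¹' {1} = {g : G | g p = 1} := by
    ext g
    simp only [mem_preimage, mem_singleton_iff, mem_ofPred_eq]
    refine ⟨fun h => congrFun h ⟨p, by simp⟩, fun h => ?_⟩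
    funext q
    obtain ⟨q, hq⟩ := q
    obtain rfl := Finset.mem_singleton.1 hq
    exact h
  have hcard : Fintype.card (GFin {p}) = (p : ℕ) ^ 2 := by
    rw [Fintype.card_pi]
    simp only [ZMod.card]
    rw [Finset.prod_coe_sort {p} fun q : Nat.Primes => (q : ℕ) ^ 2]
    simp
  rw [hset, hcard] at h
  rw [← ofReal_measureReal, h]
  congr 1
  push_cast
  ring

lemma tsum_primes_inv_sq_lt_one :
    ∑' p : Nat.Primes, ENNReal.ofReal (1 / ((p : ℕ) : ℝ) ^ 2) < 1 := by
  let F : ℕ → ℝ := fun n => 1 / ((n : ℝ) ^ 2)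
  have hz : HasSum F (Real.pi ^ 2 / 6) := hasSum_zeta_two
  have h2 : HasSum (fun n => F (n + 2)) (Real.pi ^ 2 / 6 - 1) := by
    have := (hasSum_nat_add_iff' 2).2 hz
    simpa [F, Finset.sum_range_succ] using this
  have hinj : Function.Injective fun p : Nat.Primes => (p : ℕ) - 2 := fun p q h => by
    have hp := p.2.two_le
    have hq := q.2.two_le
    simp only at h
    exact Subtype.ext (by omega)
  calc ∑' p : Nat.Primes, ENNReal.ofReal (1 / ((p : ℕ) : ℝ) ^ 2)
      = ∑' p : Nat.Primes, ENNReal.ofReal (F ((p : ℕ) - 2 + 2)) := by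
        refine tsum_congr fun p => ?_
        rw [Nat.sub_add_cancel p.2.two_le]
    _ ≤ ∑' n : ℕ, ENNReal.ofReal (F (n + 2)) :=
        ENNReal.tsum_comp_le_tsum_of_injective hinj fun n => ENNReal.ofReal (F (n + 2))
    _ = ENNReal.ofReal (Real.pi ^ 2 / 6 - 1) := by
        rw [← ENNReal.ofReal_tsum_of_nonneg (fun n => by positivity) h2.summable, h2.tsum_eq]
    _ < 1 := by
        rw [ENNReal.ofReal_lt_one]
        nlinarith [Real.pi_lt_d2, Real.pi_pos]

lemma measure_compl_G1_ne_zero (hπ : MeasurePreserving T1 π π) : π G1ᶜ ≠ 0 := by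
  intro h
  rw [prob_compl_eq_zero_iff measurableSet_G1] at h
  have hU : G1 = ⋃ p : Nat.Primes, {g : G | g p = 1} := by
    ext g
    simp [G1]
  have h1 : π G1 ≤ ∑' p : Nat.Primes, ENNReal.ofReal (1 / ((p : ℕ) : ℝ) ^ 2) := by
    rw [hU]
    exact (measure_iUnion_le _).trans_eq (tsum_congr fun p => measure_coord_eq_one hπ p)
  exact absurd (h ▸ h1) (not_le.2 tsum_primes_inv_sq_lt_one)

/-- Almost every point has infinitely many positions that are not deleted. -/
lemma ae_infinite_free (hπ : MeasurePreserving T1 π π) :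
    ∀ᵐ g ∂π, {n | Free g n}.Infinite := by
  set F : Set G := {g | ¬ {n | Free g n}.Infinite} with hF
  let F₀ : ℕ → Set G := fun N => {g | ∀ n ≥ N, ¬ Free g n}
  have hFU : F = ⋃ N, F₀ N := by
    ext g
    simp only [hF, F₀, mem_ofPred_eq, mem_iUnion, not_infinite, Set.finite_iff_bddAbove,
      bddAbove_def]
    constructor
    · rintro ⟨N, hN⟩
      exact ⟨N + 1, fun n hn h => by have := hN n h; omega⟩
    · rintro ⟨N, hN⟩
      exact ⟨N, fun n hn => by by_contra! h; exact hN n h.le hn⟩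
  have hF₀m : ∀ N, MeasurableSet (F₀ N) := fun N => by
    have : F₀ N = ⋂ n, ⋂ (_ : n ≥ N), {g | Free g n}ᶜ := by
      ext g
      simp [F₀]
    rw [this]
    exact MeasurableSet.iInter fun n => MeasurableSet.iInter fun _ => (measurableSet_free n).compl
  have hFm : MeasurableSet F := hFU ▸ MeasurableSet.iUnion hF₀m
  have hstep : ∀ N, π (F₀ N) = π (F₀ 0) := fun N => by
    rw [← (hπ.iterate N).measure_preimage (hF₀m 0).nullMeasurableSet]
    congr 1
    ext g
    simp only [F₀, mem_preimage, mem_ofPred_eq, ← free_add]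
    refine ⟨fun h n _ => h _ (by omega), fun h n hn => ?_⟩
    have := h (n - N) (by omega)
    rwa [Nat.sub_add_cancel hn] at this
  have hmono : Monotone F₀ := fun N M h g hg n hn => hg n (le_trans h hn)
  have hFF₀ : π F = π (F₀ 0) := by
    have := tendsto_measure_iUnion_atTop (μ := π) hmono
    rw [← hFU] at this
    simp only [Function.comp_def, hstep] at this
    exact tendsto_nhds_unique this tendsto_const_nhds
  have hnull : π (F ∩ G1ᶜ) = 0 := by
    have h0 : F₀ 0 ⊆ F := hFU ▸ subset_iUnion F₀ 0
    refine measure_mono_null (t := F \ F₀ 0) (fun g hg => ⟨hg.1, fun h => ?_⟩) ?_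
    · exact h 0 le_rfl ((free_zero g).2 hg.2)
    · rw [measure_sdiff h0 (hF₀m 0).nullMeasurableSet (measure_ne_top _ _), hFF₀, tsub_self]
  have hTF : T1 ⁻¹' F = F := by
    ext g
    simp only [hF, mem_preimage, mem_ofPred_eq, ← free_succ, not_iff_not]
    constructor
    · intro h
      refine (h.image (f := fun n => n + 1) fun a _ b _ hab => by simpa using hab).mono ?_
      rintro _ ⟨n, hn, rfl⟩
      exact hn
    · intro h
      by_contra hcon
      rw [not_infinite] at hcon
      refine h (((hcon.image (fun n => n + 1)).union (finite_singleton 0)).subset ?_)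
      intro n hn
      cases n with
      | zero => exact Or.inr rfl
      | succ n => exact Or.inl ⟨n, hn, rfl⟩
  change π F = 0
  by_contra hne
  have : IsProbabilityMeasure (ProbabilityTheory.cond π F) :=
    ProbabilityTheory.cond_isProbabilityMeasure hne
  have hcond : MeasurePreserving T1 (ProbabilityTheory.cond π F) (ProbabilityTheory.cond π F) := by
    refine ⟨measurable_T1, ?_⟩
    ext B hB
    rw [Measure.map_apply measurable_T1 hB, ProbabilityTheory.cond_apply hFm,
      ProbabilityTheory.cond_apply hFm, ← hπ.measure_preimage (hFm.inter hB).nullMeasurableSet,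
      preimage_inter, hTF]
  refine measure_compl_G1_ne_zero hcond ?_
  rw [ProbabilityTheory.cond_apply hFm, hnull, mul_zero]

end Rotation

local notation "wordBit" => word shift firstBit

section Decomposition

open Real (negMulLog log)

lemma negMulLog_add_sq_le {p N : ℝ} (hp : 0 ≤ p) (hN : 0 < N) :
    negMulLog p + (√p - √N⁻¹) ^ 2 ≤ p * log N + (N⁻¹ - p) := by
  rcases hp.eq_or_lt with rfl | hp
  · simp [hN.le]
  set t := √p with ht
  set u := √N⁻¹ with hu
  have ht0 : 0 < t := Real.sqrt_pos.2 hp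
  have hu0 : 0 < u := Real.sqrt_pos.2 (inv_pos.2 hN)
  have hp' : p = t ^ 2 := (Real.sq_sqrt hp.le).symm
  have hN' : N⁻¹ = u ^ 2 := (Real.sq_sqrt (inv_pos.2 hN).le).symm
  have hlogN : log N = -(2 * log u) := by
    have : log N⁻¹ = 2 * log u := by rw [hN', Real.log_pow]; norm_num
    rw [← this, Real.log_inv, neg_neg]
  have hlogp : log p = 2 * log t := by rw [hp', Real.log_pow]; norm_num
  have hlog := Real.one_sub_inv_le_log_of_pos (div_pos ht0 hu0)
  rw [Real.log_div ht0.ne' hu0.ne', inv_div] at hlog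
  rw [negMulLog, hlogp, hlogN, hp', hN']
  have := mul_le_mul_of_nonneg_left hlog (sq_nonneg t)
  have h2 : t ^ 2 * (1 - u / t) = t ^ 2 - t * u := by field_simp
  rw [h2] at this
  nlinarith

lemma sum_negMulLog_add_sq_le {β : Type*} [Fintype β] {p : β → ℝ} (hp : ∀ b, 0 ≤ p b)
    (hsum : ∑ b, p b = 1) {W : Finset β} (hW : ∀ b ∉ W, p b = 0)
    {u : β → ℝ} (hu : ∀ b ∈ W, u b = (W.card : ℝ)⁻¹) (hu' : ∀ b ∉ W, u b = 0) :
    ∑ b, negMulLog (p b) + (∑ b, (p b - u b) ^ 2) / 4 ≤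
      log W.card := by
  have hsumW : ∑ b ∈ W, p b = 1 := by
    rw [← hsum]
    exact Finset.sum_subset (Finset.subset_univ _) fun b _ hb => hW b hb
  have hne : W.Nonempty := by
    by_contra h
    rw [Finset.not_nonempty_iff_eq_empty] at h
    simp [h] at hsumW
  have hcard : (1 : ℝ) ≤ W.card := by exact_mod_cast hne.card_pos
  have hu1 : √(W.card : ℝ)⁻¹ ≤ 1 := Real.sqrt_le_one.2 (inv_le_one_of_one_le₀ hcard)
  have hle : ∀ b, p b ≤ 1 := fun b =>
    hsum ▸ Finset.single_le_sum (fun b _ => hp b) (Finset.mem_univ b)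
  have key : ∀ b ∈ W, negMulLog (p b) + (p b - (W.card : ℝ)⁻¹) ^ 2 / 4 ≤
      p b * log W.card + ((W.card : ℝ)⁻¹ - p b) := by
    intro b _
    refine le_trans ?_ (negMulLog_add_sq_le (hp b) (by linarith))
    have h1 := Real.sq_sqrt (hp b)
    have h2 := Real.sq_sqrt (inv_nonneg.2 (zero_le_one.trans hcard))
    have h3 : √(p b) ≤ 1 := Real.sqrt_le_one.2 (hle b)
    have h4 := Real.sqrt_nonneg (p b)
    have h5 := Real.sqrt_nonneg (W.card : ℝ)⁻¹
    have h6 : (√(p b) + √(W.card : ℝ)⁻¹) ^ 2 ≤ 4 := by nlinarith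
    have h7 : (p b - (W.card : ℝ)⁻¹) ^ 2 =
        (√(p b) - √(W.card : ℝ)⁻¹) ^ 2 * (√(p b) + √(W.card : ℝ)⁻¹) ^ 2 := by
      rw [← mul_pow, mul_comm (_ - _), ← sq_sub_sq, h1, h2]
    rw [h7]
    nlinarith [sq_nonneg (√(p b) - √(W.card : ℝ)⁻¹)]
  rw [Finset.sum_div, ← Finset.sum_add_distrib]
  rw [← Finset.sum_subset (Finset.subset_univ W)]
  · calc ∑ b ∈ W, (negMulLog (p b) + (p b - u b) ^ 2 / 4)
        = ∑ b ∈ W, (negMulLog (p b) + (p b - (W.card : ℝ)⁻¹) ^ 2 / 4) :=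
          Finset.sum_congr rfl fun b hb => by rw [hu b hb]
      _ ≤ ∑ b ∈ W, (p b * log W.card + ((W.card : ℝ)⁻¹ - p b)) := Finset.sum_le_sum key
      _ = log W.card := by
          rw [Finset.sum_add_distrib, ← Finset.sum_mul, Finset.sum_sub_distrib, hsumW,
            Finset.sum_const, nsmul_eq_mul, mul_inv_cancel₀ (by linarith)]
          ring
  · intro b _ hb
    simp [hW b hb, hu' b hb]

variable {S : Finset Nat.Primes}

/-- A decomposition of `ν` as an average of probability measures indexed by a finite rotation
quotient of `G`, where the component of index `c` is supported on sequences omitting the residue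
classes of `c`. -/
structure IsDecomp (ν : Measure Omega2) (P : GFin S → Measure Omega2) : Prop where
  prob : ∀ c, IsProbabilityMeasure (P c)
  mp : ∀ c, MeasurePreserving shift (P c) (P (c - 1))
  avg : ∀ B, MeasurableSet B → ν.real B = ∑ c, (Fintype.card (GFin S) : ℝ)⁻¹ * (P c).real B
  supp : ∀ c, ∀ᵐ x ∂P c, ∀ n, ¬ FreeFin c n → x n = false

/-- The words of length `n` that vanish at all positions deleted by `c`. -/
def freeWords (c : GFin S) (n : ℕ) : Finset (Fin n → Fin 2) :=
  Fintype.piFinset fun i => if FreeFin c i then Finset.univ else {0}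

/-- The uniform distribution on `freeWords c n`. -/
def unifWord (c : GFin S) (n : ℕ) (w : Fin n → Fin 2) : ℝ :=
  if w ∈ freeWords c n then ((freeWords c n).card : ℝ)⁻¹ else 0

lemma log_card_freeWords (c : GFin S) (n : ℕ) :
    log (freeWords c n).card = ∑ i : Fin n, if FreeFin c i then log 2 else 0 := by
  rw [freeWords, Fintype.card_piFinset, Nat.cast_prod, Real.log_prod]
  · refine Finset.sum_congr rfl fun i _ => ?_
    split_ifs <;> simp
  · intro i _
    split_ifs <;> simp

lemma sum_log_card_freeWords (S : Finset Nat.Primes) (n : ℕ) :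
    ∑ c : GFin S, log (freeWords c n).card =
      Fintype.card (GFin S) * (n * densFin S * log 2) := by
  simp only [log_card_freeWords]
  rw [Finset.sum_comm]
  have h : ∀ i : Fin n, (∑ c : GFin S, if FreeFin c i then log 2 else 0) =
      Fintype.card (GFin S) * densFin S * log 2 := fun i => by
    rw [← Finset.sum_filter, Finset.sum_const, nsmul_eq_mul, card_freeFin]
  rw [Finset.sum_congr rfl fun i _ => h i]
  simp only [Finset.sum_const, Finset.card_univ, Fintype.card_fin, nsmul_eq_mul]
  ring

lemma sum_measureReal_fiber {α β : Type*} [MeasurableSpace α] [Fintype β] [MeasurableSpace β]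
    [MeasurableSingletonClass β] (μ : Measure α) [IsProbabilityMeasure μ] {f : α → β}
    (hf : Measurable f) : ∑ b, μ.real (f ⁻¹' {b}) = 1 := by
  have := measureReal_preimage_eq_sum μ hf MeasurableSet.univ
  simpa using this.symm

variable {ν : Measure Omega2} {P : GFin S → Measure Omega2}

lemma measurable_wordBit (n : ℕ) : Measurable (wordBit n) :=
  measurable_word measurable_shift measurable_firstBit n

lemma wordBit_apply (n : ℕ) (x : Omega2) (i : Fin n) : wordBit n x i = if x i then 1 else 0 := by
  simp [word, firstBit, shift_iterate_apply]

namespace IsDecomp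

/-- The average of the entropies of the components. -/
def avgH (P : GFin S → Measure Omega2) (n : ℕ) : ℝ :=
  ∑ c, (Fintype.card (GFin S) : ℝ)⁻¹ * partH (P c) (wordBit n)

lemma partH_le (h : IsDecomp ν P) (n : ℕ) :
    partH ν (wordBit n) ≤ avgH P n + log (Fintype.card (GFin S)) := by
  have := h.prob
  rw [partH_eq_sum_real]
  have h1 : ∀ w, negMulLog (ν.real (wordBit n ⁻¹' {w})) ≤
      ∑ c, negMulLog ((Fintype.card (GFin S) : ℝ)⁻¹ * (P c).real (wordBit n ⁻¹' {w})) := fun w => by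
    rw [h.avg _ (measurable_wordBit n (measurableSet_singleton w))]
    exact negMulLog_sum_le _ _ fun c => by positivity
  refine (Finset.sum_le_sum fun w _ => h1 w).trans_eq ?_
  rw [Finset.sum_comm]
  have h2 : ∀ c, ∑ w, negMulLog ((Fintype.card (GFin S) : ℝ)⁻¹ *
      (P c).real (wordBit n ⁻¹' {w})) = (Fintype.card (GFin S) : ℝ)⁻¹ * partH (P c) (wordBit n) +
        negMulLog (Fintype.card (GFin S) : ℝ)⁻¹ := fun c => by
    simp only [Real.negMulLog_mul]
    rw [Finset.sum_add_distrib, ← Finset.sum_mul, ← Finset.mul_sum,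
      sum_measureReal_fiber _ (measurable_wordBit n), partH_eq_sum_real]
    ring
  rw [Finset.sum_congr rfl fun c _ => h2 c, Finset.sum_add_distrib, avgH]
  congr 1
  rw [Finset.sum_const, Finset.card_univ, nsmul_eq_mul, negMulLog, Real.log_inv, neg_mul_neg,
    mul_inv_cancel_left₀ (Nat.cast_ne_zero.2 Fintype.card_ne_zero)]

lemma partH_iterate (h : IsDecomp ν P) (a b : ℕ) (c : GFin S) :
    partH (P c) (wordBit b ∘ shift^[a]) = partH (P (c - a)) (wordBit b) := by
  have hmp : ∀ a : ℕ, MeasurePreserving shift^[a] (P c) (P (c - a)) := by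
    intro a
    induction a with
    | zero => simpa using MeasurePreserving.id (P c)
    | succ a ih =>
      rw [Function.iterate_succ', Nat.cast_succ, ← sub_sub]
      exact (h.mp _).comp ih
  rw [partH_comp _ (hmp a).measurable (measurable_wordBit b), (hmp a).map_eq]

lemma avgH_add_le (h : IsDecomp ν P) (a b : ℕ) : avgH P (a + b) ≤ avgH P a + avgH P b := by
  have := h.prob
  have h1 : avgH P b = ∑ c, (Fintype.card (GFin S) : ℝ)⁻¹ * partH (P (c - a)) (wordBit b) :=
    ((Equiv.subRight (a : GFin S)).sum_comp fun c =>
      (Fintype.card (GFin S) : ℝ)⁻¹ * partH (P c) (wordBit b)).symm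
  rw [h1, avgH, avgH, ← Finset.sum_add_distrib]
  refine Finset.sum_le_sum fun c _ => ?_
  rw [← mul_add, ← h.partH_iterate]
  exact mul_le_mul_of_nonneg_left
    (partH_word_add_le_comp measurable_shift measurable_firstBit a b) (by positivity)

lemma avgH_mul_le (h : IsDecomp ν P) (k n : ℕ) : avgH P (k * n) ≤ k * avgH P n := by
  have := h.prob
  induction k with
  | zero =>
    rw [zero_mul, Nat.cast_zero, zero_mul]
    exact Finset.sum_nonpos fun c _ => mul_nonpos_of_nonneg_of_nonpos (by positivity)
      (partH_word_zero_le _ _)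
  | succ k ih =>
    rw [Nat.succ_mul]
    push_cast
    linarith [h.avgH_add_le (k * n) n]

lemma mul_procH_le [IsProbabilityMeasure ν] (h : IsDecomp ν P) (n : ℕ) :
    n * procH ν shift firstBit ≤ avgH P n := by
  refine le_of_forall_nat_mul_le (C := log (Fintype.card (GFin S))) fun k => ?_
  have h1 := mul_procH_le_partH_word (μ := ν) (T := shift) firstBit (k * n)
  push_cast at h1
  rw [mul_assoc] at h1
  linarith [h.partH_le (k * n), h.avgH_mul_le k n]

lemma partH_component_add_le (h : IsDecomp ν P) (c : GFin S) (n : ℕ) :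
    partH (P c) (wordBit n) +
      (∑ w, ((P c).real (wordBit n ⁻¹' {w}) - unifWord c n w) ^ 2) / 4 ≤
        log (freeWords c n).card := by
  have := h.prob c
  rw [partH_eq_sum_real]
  refine sum_negMulLog_add_sq_le (fun _ => measureReal_nonneg)
    (sum_measureReal_fiber _ (measurable_wordBit n)) (fun w hw => ?_)
    (fun w hw => if_pos hw) fun w hw => if_neg hw
  rw [measureReal_eq_zero_iff, measure_eq_zero_iff_ae_notMem]
  filter_upwards [h.supp c] with x hx hxw
  refine hw ?_
  rw [← show wordBit n x = w from hxw, freeWords, Fintype.mem_piFinset]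
  intro i
  split_ifs with hi
  · exact Finset.mem_univ _
  · rw [Finset.mem_singleton, wordBit_apply, hx i hi]
    simp

/-- The entropy deficit bounds the distance of the components to the uniform distributions. -/
lemma mul_procH_add_le [IsProbabilityMeasure ν] (h : IsDecomp ν P) (n : ℕ) :
    n * procH ν shift firstBit +
      ∑ c, (Fintype.card (GFin S) : ℝ)⁻¹ *
        ((∑ w, ((P c).real (wordBit n ⁻¹' {w}) - unifWord c n w) ^ 2) / 4) ≤
      n * densFin S * log 2 := by
  have hQ : (Fintype.card (GFin S) : ℝ) ≠ 0 := Nat.cast_ne_zero.2 Fintype.card_ne_zero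
  calc _ ≤ avgH P n + ∑ c, (Fintype.card (GFin S) : ℝ)⁻¹ *
        ((∑ w, ((P c).real (wordBit n ⁻¹' {w}) - unifWord c n w) ^ 2) / 4) :=
        add_le_add (h.mul_procH_le n) le_rfl
    _ ≤ ∑ c : GFin S, (Fintype.card (GFin S) : ℝ)⁻¹ * log (freeWords c n).card := by
        rw [avgH, ← Finset.sum_add_distrib]
        refine Finset.sum_le_sum fun c _ => ?_
        rw [← mul_add]
        exact mul_le_mul_of_nonneg_left (h.partH_component_add_le c n) (by positivity)
    _ = _ := by
        rw [← Finset.mul_sum, sum_log_card_freeWords, inv_mul_cancel_left₀ hQ]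

lemma procH_le [IsProbabilityMeasure ν] (h : IsDecomp ν P) :
    procH ν shift firstBit ≤ densFin S * log 2 := by
  have := h.mul_procH_add_le 1
  have h2 : 0 ≤ ∑ c, (Fintype.card (GFin S) : ℝ)⁻¹ *
        ((∑ w, ((P c).real (wordBit 1 ⁻¹' {w}) - unifWord c 1 w) ^ 2) / 4) := by positivity
  simp only [Nat.cast_one, one_mul] at this
  linarith

/-- For each word and each set `C` of residues, the decomposition is close to uniform when the
entropy is close to maximal. -/
lemma sq_sum_sub_le [IsProbabilityMeasure ν] (h : IsDecomp ν P) {ε : ℝ}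
    (hε : densFin S * log 2 ≤ procH ν shift firstBit + ε) (n : ℕ) (w : Fin n → Fin 2)
    (C : Finset (GFin S)) :
    (∑ c ∈ C, (Fintype.card (GFin S) : ℝ)⁻¹ * (P c).real (wordBit n ⁻¹' {w}) -
      ∑ c ∈ C, (Fintype.card (GFin S) : ℝ)⁻¹ * unifWord c n w) ^ 2 ≤ 4 * n * ε := by
  set Q : ℝ := (Fintype.card (GFin S) : ℝ) with hQdef
  have hQ : 0 < Q := Nat.cast_pos.2 Fintype.card_pos
  let d : GFin S → ℝ := fun c => (P c).real (wordBit n ⁻¹' {w}) - unifWord c n w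
  have h1 : ∑ c, Q⁻¹ * (d c ^ 2 / 4) ≤ n * ε := by
    have h2 := h.mul_procH_add_le n
    have h3 : ∑ c, Q⁻¹ * (d c ^ 2 / 4) ≤ ∑ c, Q⁻¹ *
        ((∑ w, ((P c).real (wordBit n ⁻¹' {w}) - unifWord c n w) ^ 2) / 4) := by
      refine Finset.sum_le_sum fun c _ => ?_
      have : d c ^ 2 ≤ ∑ w, ((P c).real (wordBit n ⁻¹' {w}) - unifWord c n w) ^ 2 :=
        Finset.single_le_sum
          (f := fun w => ((P c).real (wordBit n ⁻¹' {w}) - unifWord c n w) ^ 2)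
          (fun w _ => sq_nonneg _) (Finset.mem_univ w)
      gcongr
    have h4 := mul_le_mul_of_nonneg_left hε (Nat.cast_nonneg (α := ℝ) n)
    rw [← mul_assoc, mul_add] at h4
    linarith
  have h5 : (∑ c ∈ C, d c) ^ 2 ≤ Q * ∑ c, d c ^ 2 := by
    refine (sq_sum_le_card_mul_sum_sq (s := C) (f := d)).trans ?_
    refine mul_le_mul ?_ ?_ (by positivity) hQ.le
    · rw [hQdef]; exact_mod_cast Finset.card_le_univ C
    · exact Finset.sum_le_sum_of_subset_of_nonneg (Finset.subset_univ _) fun c _ _ => sq_nonneg _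
  rw [← Finset.mul_sum, ← Finset.mul_sum, ← mul_sub, ← Finset.sum_sub_distrib, mul_pow]
  calc Q⁻¹ ^ 2 * (∑ c ∈ C, d c) ^ 2 ≤ Q⁻¹ ^ 2 * (Q * ∑ c, d c ^ 2) := by gcongr
    _ = 4 * ∑ c, Q⁻¹ * (d c ^ 2 / 4) := by
      rw [← Finset.mul_sum, ← Finset.sum_div]
      field_simp
    _ ≤ 4 * n * ε := by linarith

end IsDecomp

end Decomposition

section MaximalEntropy

open Real (log)

lemma wordBit_eq_iff {n : ℕ} {x y : Omega2} :
    wordBit n x = wordBit n y ↔ ∀ i < n, x i = y i := by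
  constructor
  · intro h i hi
    have := congrFun h ⟨i, hi⟩
    rw [wordBit_apply, wordBit_apply] at this
    cases hx : x i <;> cases hy : y i <;> simp_all
  · intro h
    funext i
    rw [wordBit_apply, wordBit_apply, h i i.2]

lemma ext_of_words {μ μ' : Measure (G × Omega2)} [IsProbabilityMeasure μ]
    [IsProbabilityMeasure μ']
    (h : ∀ (S : Finset Nat.Primes) (C : Set (GFin S)) (n : ℕ) (w : Fin n → Fin 2),
      μ.real {z | resFin S z.1 ∈ C ∧ z.2 ∈ wordBit n ⁻¹' {w}} =
        μ'.real {z | resFin S z.1 ∈ C ∧ z.2 ∈ wordBit n ⁻¹' {w}}) : μ = μ' := by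
  refine ext_of_generate_finite _ generateFrom_cylinderSets
    isSetRing_cylinderSets.isSetSemiring.isPiSystem
    (fun B hB => ?_) (by simp)
  have hBm := measurableSet_of_mem_cylinderSets hB
  obtain ⟨S, n, hB⟩ := hB
  have hm : Measurable fun z : G × Omega2 => wordBit n z.2 :=
    (measurable_wordBit n).comp measurable_snd
  rw [← ENNReal.toReal_eq_toReal_iff' (measure_ne_top _ _) (measure_ne_top _ _)]
  change μ.real B = μ'.real B
  rw [measureReal_preimage_eq_sum μ hm hBm, measureReal_preimage_eq_sum μ' hm hBm]
  refine Finset.sum_congr rfl fun w _ => ?_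
  convert h S {c | ∃ z ∈ B, resFin S z.1 = c ∧ wordBit n z.2 = w} n w using 2 <;>
  · ext z
    simp only [mem_inter_iff, mem_preimage, mem_singleton_iff, mem_ofPred_eq]
    constructor
    · exact fun hz => ⟨⟨z, hz.2, rfl, hz.1⟩, hz.1⟩
    · rintro ⟨⟨z', hz', hr, hw'⟩, hw⟩
      refine ⟨hw, ?_⟩
      exact (hB z' z (fun p hp => congrFun hr ⟨p, hp⟩)
        (wordBit_eq_iff.1 (hw'.trans hw.symm))).mp hz'

lemma ext_of_words_snd {ν ν' : Measure Omega2} [IsProbabilityMeasure ν] [IsProbabilityMeasure ν']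
    (h : ∀ (n : ℕ) (w : Fin n → Fin 2),
      ν.real (wordBit n ⁻¹' {w}) = ν'.real (wordBit n ⁻¹' {w})) : ν = ν' := by
  have : (Measure.dirac (0 : G)).prod ν = (Measure.dirac (0 : G)).prod ν' := by
    refine ext_of_words fun S C n w => ?_
    have hset : {z : G × Omega2 | resFin S z.1 ∈ C ∧ z.2 ∈ wordBit n ⁻¹' {w}} =
        (resFin S ⁻¹' C) ×ˢ (wordBit n ⁻¹' {w}) := rfl
    rw [hset, measureReal_prod_prod, measureReal_prod_prod, h]
  have h2 := congrArg (fun μ => μ.map Prod.snd) this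
  simpa using h2

lemma IsDecomp.sq_sub_le {S : Finset Nat.Primes} {ν ν' : Measure Omega2}
    [IsProbabilityMeasure ν] [IsProbabilityMeasure ν']
    {P P' : GFin S → Measure Omega2} (h : IsDecomp ν P) (h' : IsDecomp ν' P') {ε : ℝ}
    (hε : densFin S * log 2 ≤ procH ν shift firstBit + ε)
    (hε' : densFin S * log 2 ≤ procH ν' shift firstBit + ε) (n : ℕ) (w : Fin n → Fin 2)
    (C : Finset (GFin S)) :
    (∑ c ∈ C, (Fintype.card (GFin S) : ℝ)⁻¹ * (P c).real (wordBit n ⁻¹' {w}) -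
      ∑ c ∈ C, (Fintype.card (GFin S) : ℝ)⁻¹ * (P' c).real (wordBit n ⁻¹' {w})) ^ 2 ≤
        16 * n * ε := by
  have h1 := h.sq_sum_sub_le hε n w C
  have h2 := h'.sq_sum_sub_le hε' n w C
  generalize ∑ c ∈ C, (Fintype.card (GFin S) : ℝ)⁻¹ * (P c).real (wordBit n ⁻¹' {w}) = a at *
  generalize ∑ c ∈ C, (Fintype.card (GFin S) : ℝ)⁻¹ * (P' c).real (wordBit n ⁻¹' {w}) = b at *
  generalize ∑ c ∈ C, (Fintype.card (GFin S) : ℝ)⁻¹ * unifWord c n w = u at *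
  nlinarith [sq_nonneg (a + b - 2 * u)]

lemma eq_of_sq_sub_le {a b K : ℝ} (h : ∀ ε > 0, (a - b) ^ 2 ≤ K * ε) : a = b := by
  have h0 : (a - b) ^ 2 ≤ 0 := by
    have ht : Tendsto (fun ε => K * ε) (nhdsWithin (0 : ℝ) (Ioi 0)) (nhds 0) := by
      simpa using ((continuous_const_mul K).tendsto (0 : ℝ)).mono_left nhdsWithin_le_nhds
    refine ge_of_tendsto ht ?_
    filter_upwards [self_mem_nhdsWithin] with ε hε using h ε hε
  have := pow_eq_zero_iff (two_ne_zero) |>.1 (le_antisymm h0 (sq_nonneg _))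
  linarith

variable {m : Measure G} [IsProbabilityMeasure m]

lemma procH_le_of_decomp (hm : MeasurePreserving T1 m m) {ν : Measure Omega2}
    [IsProbabilityMeasure ν]
    (hν : ∀ S : Finset Nat.Primes, ∃ P : GFin S → Measure Omega2, IsDecomp ν P) :
    procH ν shift firstBit ≤ m.real G1ᶜ * log 2 := by
  refine le_of_forall_pos_le_add fun ε hε => ?_
  have hlog : 0 < log 2 := Real.log_pos one_lt_two
  obtain ⟨S, -, hS⟩ := exists_densFin_lt hm (div_pos hε hlog) ∅
  obtain ⟨P, hP⟩ := hν S
  refine hP.procH_le.trans ?_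
  have := mul_le_mul_of_nonneg_right hS.le hlog.le
  rwa [add_mul, div_mul_cancel₀ _ hlog.ne'] at this

lemma eq_of_decomp (hm : MeasurePreserving T1 m m) {ν ν' : Measure Omega2}
    [IsProbabilityMeasure ν] [IsProbabilityMeasure ν']
    (hν : ∀ S : Finset Nat.Primes, ∃ P : GFin S → Measure Omega2, IsDecomp ν P)
    (hν' : ∀ S : Finset Nat.Primes, ∃ P : GFin S → Measure Omega2, IsDecomp ν' P)
    (hH : m.real G1ᶜ * log 2 ≤ procH ν shift firstBit)
    (hH' : m.real G1ᶜ * log 2 ≤ procH ν' shift firstBit) : ν = ν' := by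
  refine ext_of_words_snd fun n w => eq_of_sq_sub_le (K := 16 * n * log 2) fun ε hε => ?_
  obtain ⟨S, -, hS⟩ := exists_densFin_lt hm hε ∅
  obtain ⟨P, hP⟩ := hν S
  obtain ⟨P', hP'⟩ := hν' S
  have hlog := mul_le_mul_of_nonneg_right hS.le (Real.log_nonneg one_le_two)
  have hmeas := measurable_wordBit n (measurableSet_singleton w)
  rw [hP.avg _ hmeas, hP'.avg _ hmeas]
  refine (hP.sq_sub_le hP' (ε := ε * log 2) (by linarith) (by linarith) n w _).trans_eq ?_
  ring

/-- Sequences omitting the residue classes of `c`. -/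
def omitSet {S : Finset Nat.Primes} (c : GFin S) : Set Omega2 :=
  {x | ∀ n, ¬ FreeFin c n → x n = false}

lemma measurableSet_omitSet {S : Finset Nat.Primes} (c : GFin S) : MeasurableSet (omitSet c) := by
  have : omitSet c = ⋂ n, ⋂ (_ : ¬ FreeFin c n), (fun x : Omega2 => x n) ⁻¹' {false} := by
    ext x
    simp [omitSet]
  rw [this]
  exact MeasurableSet.iInter fun n => MeasurableSet.iInter fun _ =>
    measurable_pi_apply n (measurableSet_singleton _)

/-- Invariant measures on pairs `(g, x)` such that `x` vanishes at the positions deleted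
by `g`. -/
structure IsJoint (μ : Measure (G × Omega2)) : Prop where
  mp : MeasurePreserving rotShift μ μ
  supp : ∀ᵐ z ∂μ, ∀ n, ¬ Free z.1 n → z.2 n = false

lemma IsJoint.exists_decomp {μ : Measure (G × Omega2)} [IsProbabilityMeasure μ]
    (h : IsJoint μ) (S : Finset Nat.Primes) :
    ∃ P : GFin S → Measure Omega2, IsDecomp (μ.map Prod.snd) P ∧
      ∀ (C : Finset (GFin S)) (B : Set Omega2), MeasurableSet B →
        μ.real {z | resFin S z.1 ∈ C ∧ z.2 ∈ B} =
          ∑ c ∈ C, (Fintype.card (GFin S) : ℝ)⁻¹ * (P c).real B := by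
  have hres : Measurable fun z : G × Omega2 => resFin S z.1 :=
    (measurable_resFin S).comp measurable_fst
  have hA : ∀ c, MeasurableSet {z : G × Omega2 | resFin S z.1 = c} := fun c =>
    hres (measurableSet_singleton c)
  have hfst : MeasurePreserving T1 (μ.map Prod.fst) (μ.map Prod.fst) := by
    refine ⟨measurable_T1, ?_⟩
    rw [Measure.map_map measurable_T1 measurable_fst]
    conv_rhs => rw [← h.mp.map_eq, Measure.map_map measurable_fst measurable_rotShift]
    rfl
  have := Measure.isProbabilityMeasure_map (μ := μ) measurable_fst.aemeasurable
  have hQ : (Fintype.card (GFin S) : ℝ) ≠ 0 := Nat.cast_ne_zero.2 Fintype.card_ne_zero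
  let P : GFin S → Measure Omega2 := fun c =>
    (Fintype.card (GFin S) : ℝ≥0∞) • (μ.restrict {z | resFin S z.1 = c}).map Prod.snd
  have hP : ∀ c B, MeasurableSet B →
      P c B = Fintype.card (GFin S) * μ {z | resFin S z.1 = c ∧ z.2 ∈ B} := fun c B hB => by
    simp only [P, Measure.smul_apply, smul_eq_mul]
    rw [Measure.map_apply measurable_snd hB, Measure.restrict_apply (measurable_snd hB),
      inter_comm]
    rfl
  have hPr : ∀ c B, MeasurableSet B →
      (Fintype.card (GFin S) : ℝ)⁻¹ * (P c).real B =
        μ.real {z | resFin S z.1 = c ∧ z.2 ∈ B} := fun c B hB => by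
    rw [measureReal_def, hP c B hB, ENNReal.toReal_mul, ENNReal.toReal_natCast,
      inv_mul_cancel_left₀ hQ]
    rfl
  have hsum : ∀ (C : Finset (GFin S)) (B : Set Omega2), MeasurableSet B →
        μ.real {z | resFin S z.1 ∈ C ∧ z.2 ∈ B} =
          ∑ c ∈ C, (Fintype.card (GFin S) : ℝ)⁻¹ * (P c).real B := by
    intro C B hB
    rw [Finset.sum_congr rfl fun c _ => hPr c B hB, ← measureReal_biUnion_finset]
    · congr 1
      ext z
      simp
    · intro a _ b _ hab
      exact Set.disjoint_left.2 fun z hz hz' => hab (hz.1.symm.trans hz'.1)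
    · exact fun c _ => (hA c).inter (measurable_snd hB)
  refine ⟨P, ⟨fun c => ⟨?_⟩, fun c => ⟨measurable_shift, ?_⟩, fun B hB => ?_, fun c => ?_⟩, hsum⟩
  · have h1 := measureReal_resFin hfst S c
    rw [measureReal_def, Measure.map_apply measurable_fst
      (measurable_resFin S (measurableSet_singleton c))] at h1
    have h2 := hP c univ MeasurableSet.univ
    rw [h2, show {z : G × Omega2 | resFin S z.1 = c ∧ z.2 ∈ univ} =
      Prod.fst ⁻¹' (resFin S ⁻¹' {c}) by ext z; simp]
    rw [← ENNReal.toReal_eq_one_iff, ENNReal.toReal_mul, h1, ENNReal.toReal_natCast,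
      mul_inv_cancel₀ hQ]
  · ext B hB
    rw [Measure.map_apply measurable_shift hB, hP _ _ (measurable_shift hB), hP _ _ hB]
    have := h.mp.measure_preimage ((hA (c - 1)).inter (measurable_snd hB)).nullMeasurableSet
    refine congrArg _ (Eq.trans ?_ this)
    congr 1
    ext z
    simp only [mem_ofPred_eq, mem_preimage, mem_inter_iff, rotShift, Prod.map_fst, Prod.map_snd]
    rw [show resFin S (T1 z.1) = resFin S z.1 - 1 from rfl, sub_left_inj]
  · rw [← hsum Finset.univ B hB, map_measureReal_apply measurable_snd hB]
    congr 1
    ext z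
    simp
  · refine Measure.ae_smul_measure ?_ _
    rw [ae_map_iff measurable_snd.aemeasurable (measurableSet_omitSet c),
      ae_restrict_iff' (hA c)]
    filter_upwards [h.supp] with z hz hc n hn
    refine hz n fun hfree => hn fun p hp => hfree ⟨p, ?_⟩
    rw [hp, ← hc]
    rfl

lemma IsJoint.procH_le (hm : MeasurePreserving T1 m m) {μ : Measure (G × Omega2)}
    [IsProbabilityMeasure μ] (h : IsJoint μ) :
    procH (μ.map Prod.snd) shift firstBit ≤ m.real G1ᶜ * log 2 :=
  have := Measure.isProbabilityMeasure_map (μ := μ) measurable_snd.aemeasurable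
  procH_le_of_decomp hm fun S => (h.exists_decomp S).imp fun _ => And.left

lemma IsJoint.eq (hm : MeasurePreserving T1 m m) {μ μ' : Measure (G × Omega2)}
    [IsProbabilityMeasure μ] [IsProbabilityMeasure μ'] (h : IsJoint μ) (h' : IsJoint μ')
    (hH : m.real G1ᶜ * log 2 ≤ procH (μ.map Prod.snd) shift firstBit)
    (hH' : m.real G1ᶜ * log 2 ≤ procH (μ'.map Prod.snd) shift firstBit) : μ = μ' := by
  have := Measure.isProbabilityMeasure_map (μ := μ) measurable_snd.aemeasurable
  have := Measure.isProbabilityMeasure_map (μ := μ') measurable_snd.aemeasurable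
  refine ext_of_words fun S₀ C n w => eq_of_sq_sub_le (K := 16 * n * log 2) fun ε hε => ?_
  obtain ⟨S, hS₀, hS⟩ := exists_densFin_lt hm hε S₀
  obtain ⟨P, hP, hPs⟩ := h.exists_decomp S
  obtain ⟨P', hP', hPs'⟩ := h'.exists_decomp S
  have hlog := mul_le_mul_of_nonneg_right hS.le (Real.log_nonneg one_le_two)
  have hmeas := measurable_wordBit n (measurableSet_singleton w)
  let C' : Finset (GFin S) := Finset.univ.filter fun c =>
    (fun p : S₀ => c ⟨p, hS₀ p.2⟩ : GFin S₀) ∈ C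
  have hC : {z : G × Omega2 | resFin S₀ z.1 ∈ C ∧ z.2 ∈ wordBit n ⁻¹' {w}} =
      {z | resFin S z.1 ∈ C' ∧ z.2 ∈ wordBit n ⁻¹' {w}} := by
    ext z
    simp only [C', Finset.mem_filter, Finset.mem_univ, true_and]
    rfl
  rw [hC, hPs C' _ hmeas, hPs' C' _ hmeas]
  refine (hP.sq_sub_le hP' (ε := ε * log 2) (by linarith) (by linarith) n w _).trans_eq ?_
  ring

lemma measurableSet_sqfFlow : MeasurableSet SqfFlow := by
  have : SqfFlow = ⋂ p : Nat.Primes, ⋃ a : ZMod ((p : ℕ) ^ 2), ⋂ n : ℕ,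
      ⋂ (_ : ((n + 1 : ℕ) : ZMod ((p : ℕ) ^ 2)) = a), (fun x : Omega2 => x n) ⁻¹' {false} := by
    ext x
    simp [SqfFlow, OmitsMod]
  rw [this]
  exact MeasurableSet.iInter fun p => MeasurableSet.iUnion fun a => MeasurableSet.iInter fun n =>
    MeasurableSet.iInter fun _ => measurable_pi_apply n (measurableSet_singleton _)

lemma exists_mem_omitSet {x : Omega2} (hx : x ∈ SqfFlow) (S : Finset Nat.Primes) :
    ∃ c : GFin S, x ∈ omitSet c := by
  choose a ha using hx
  refine ⟨fun p => a p, fun n hn => ?_⟩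
  simp only [FreeFin, not_forall, not_not] at hn
  obtain ⟨p, hp⟩ := hn
  exact ha p n hp

lemma shift_mem_omitSet {S : Finset Nat.Primes} {c : GFin S} {x : Omega2} (hx : x ∈ omitSet c) :
    shift x ∈ omitSet (c - 1) := fun n hn => hx (n + 1) fun h => hn ((freeFin_succ c n).1 h)

/-- The residue vectors omitted by `x`. -/
def omitted (S : Finset Nat.Primes) (x : Omega2) : Finset (GFin S) :=
  Finset.univ.filter fun c => x ∈ omitSet c

lemma mem_omitted {S : Finset Nat.Primes} {x : Omega2} {c : GFin S} :
    c ∈ omitted S x ↔ x ∈ omitSet c := by simp [omitted]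

lemma image_omitted_subset (S : Finset Nat.Primes) (x : Omega2) :
    (omitted S x).image (fun c => c - 1) ⊆ omitted S (shift x) := by
  intro c hc
  obtain ⟨c', hc', rfl⟩ := Finset.mem_image.1 hc
  exact mem_omitted.2 (shift_mem_omitSet (mem_omitted.1 hc'))

lemma card_image_omitted (S : Finset Nat.Primes) (x : Omega2) :
    ((omitted S x).image (fun c => c - 1)).card = (omitted S x).card :=
  Finset.card_image_of_injective _ (sub_left_injective)

lemma measurable_card_omitted (S : Finset Nat.Primes) :
    Measurable fun x => ((omitted S x).card : ℝ≥0∞) := by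
  have : (fun x => ((omitted S x).card : ℝ≥0∞)) =
      fun x => ∑ c : GFin S, (omitSet c).indicator (fun _ => 1) x := by
    funext x
    simp [omitted, Set.indicator_apply]
  rw [this]
  exact Finset.measurable_sum _ fun c _ => measurable_const.indicator (measurableSet_omitSet c)

lemma ae_omitted_shift {ν : Measure Omega2} [IsProbabilityMeasure ν]
    (hν : MeasurePreserving shift ν ν) (S : Finset Nat.Primes) :
    ∀ᵐ x ∂ν, ∀ c : GFin S, x ∈ omitSet c ↔ shift x ∈ omitSet (c - 1) := by
  have hle : ∀ x, ((omitted S x).card : ℝ≥0∞) ≤ (omitted S (shift x)).card := fun x => by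
    rw [← card_image_omitted]
    exact_mod_cast Finset.card_le_card (image_omitted_subset S x)
  have h_int := hν.lintegral_comp (measurable_card_omitted S)
  have hfin : ∫⁻ x, ((omitted S x).card : ℝ≥0∞) ∂ν ≠ ∞ := by
    refine ne_top_of_le_ne_top (b := (Fintype.card (GFin S) : ℝ≥0∞)) (ENNReal.natCast_ne_top _) ?_
    calc ∫⁻ x, ((omitted S x).card : ℝ≥0∞) ∂ν
        ≤ ∫⁻ _, (Fintype.card (GFin S) : ℝ≥0∞) ∂ν :=
          lintegral_mono fun x => Nat.cast_le.2 (Finset.card_le_univ _)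
      _ = Fintype.card (GFin S) := by rw [lintegral_const, measure_univ, mul_one]
  have hae := ae_eq_of_ae_le_of_lintegral_le (ae_of_all ν hle) hfin
    ((measurable_card_omitted S).comp measurable_shift).aemeasurable h_int.le
  filter_upwards [hae] with x hx c
  refine ⟨shift_mem_omitSet, fun h => ?_⟩
  have hcard : (omitted S x).card = (omitted S (shift x)).card := by exact_mod_cast hx
  have himg := Finset.eq_of_subset_of_card_le (image_omitted_subset S x)
    (by rw [card_image_omitted, hcard])
  rw [← mem_omitted, ← himg, Finset.mem_image] at h
  obtain ⟨c', hc', hcc⟩ := h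
  rw [sub_left_inj] at hcc
  exact mem_omitted.1 (hcc ▸ hc')

lemma exists_decomp_of_sqfFlow {ν : Measure Omega2} [IsProbabilityMeasure ν]
    (hν : MeasurePreserving shift ν ν) (hX : ν SqfFlow = 1) (S : Finset Nat.Primes) :
    ∃ P : GFin S → Measure Omega2, IsDecomp ν P := by
  have hQ : (Fintype.card (GFin S) : ℝ≥0∞) ≠ 0 := Nat.cast_ne_zero.2 Fintype.card_ne_zero
  have hQ' : (Fintype.card (GFin S) : ℝ≥0∞) ≠ ∞ := ENNReal.natCast_ne_top _
  let d : GFin S → Omega2 → ℝ≥0∞ := fun c =>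
    (omitSet c).indicator fun x => ((omitted S x).card : ℝ≥0∞)⁻¹
  have hd : ∀ c, Measurable (d c) := fun c =>
    (measurable_card_omitted S).inv.indicator (measurableSet_omitSet c)
  have hsumd : ∀ᵐ x ∂ν, ∑ c, d c x = 1 := by
    have := (prob_compl_eq_zero_iff measurableSet_sqfFlow).2 hX
    have hae : ∀ᵐ x ∂ν, x ∈ SqfFlow := this
    filter_upwards [hae] with x hx
    obtain ⟨c, hc⟩ := exists_mem_omitSet hx S
    have hne : (omitted S x).card ≠ 0 := Finset.card_ne_zero_of_mem (mem_omitted.2 hc)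
    simp only [d, Set.indicator_apply]
    rw [← Finset.sum_filter, Finset.sum_const, nsmul_eq_mul]
    exact ENNReal.mul_inv_cancel (Nat.cast_ne_zero.2 hne) (ENNReal.natCast_ne_top _)
  have hdshift : ∀ c, ∀ᵐ x ∂ν, d c x = d (c - 1) (shift x) := fun c => by
    filter_upwards [ae_omitted_shift hν S] with x hx
    have hcard : (omitted S (shift x)).card = (omitted S x).card := by
      rw [← card_image_omitted S x]
      congr 1
      ext c'
      rw [mem_omitted, Finset.mem_image]
      constructor
      · intro h
        refine ⟨c' + 1, mem_omitted.2 ((hx _).2 (by rwa [add_sub_cancel_right])),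
          add_sub_cancel_right _ _⟩
      · rintro ⟨c'', h, rfl⟩
        exact (hx _).1 (mem_omitted.1 h)
    simp only [d, Set.indicator_apply, hcard, hx c]
  let P : GFin S → Measure Omega2 := fun c => (Fintype.card (GFin S) : ℝ≥0∞) • ν.withDensity (d c)
  have hP : ∀ c B, MeasurableSet B →
      P c B = Fintype.card (GFin S) * ∫⁻ x in B, d c x ∂ν := fun c B hB => by
    simp only [P, Measure.smul_apply, smul_eq_mul, withDensity_apply _ hB]
  have hmp : ∀ c, MeasurePreserving shift (P c) (P (c - 1)) := fun c => by
    refine ⟨measurable_shift, ?_⟩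
    ext B hB
    rw [Measure.map_apply measurable_shift hB, hP _ _ (measurable_shift hB), hP _ _ hB,
      ← hν.setLIntegral_comp_preimage hB (hd (c - 1))]
    congr 1
    exact setLIntegral_congr_fun_ae (measurable_shift hB) ((hdshift c).mono fun x hx _ => hx)
  have hsum : ∀ B, MeasurableSet B → ∑ c, P c B = Fintype.card (GFin S) * ν B := fun B hB => by
    rw [Finset.sum_congr rfl fun c _ => hP c B hB, ← Finset.mul_sum,
      ← lintegral_finsetSum _ fun c _ => hd c,
      lintegral_congr_ae (ae_restrict_of_ae hsumd), setLIntegral_const, one_mul]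
  have hprob : ∀ c, IsProbabilityMeasure (P c) := fun c => by
    have hconst := gfin_eq_of_sub_one (φ := fun c => P c univ) fun c => by
      rw [← (hmp c).measure_preimage MeasurableSet.univ.nullMeasurableSet, preimage_univ]
    have h1 := hsum univ MeasurableSet.univ
    have h2 : ∑ c', P c' univ = ∑ _c' : GFin S, P c univ :=
      Finset.sum_congr rfl fun c' _ => hconst c' c
    rw [h2, Finset.sum_const, Finset.card_univ, nsmul_eq_mul, measure_univ (μ := ν)] at h1
    exact ⟨(ENNReal.mul_right_inj hQ hQ').1 h1⟩
  refine ⟨P, hprob, hmp, fun B hB => ?_, fun c => ?_⟩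
  · have h1 := congrArg ENNReal.toReal (hsum B hB)
    rw [ENNReal.toReal_sum fun c _ => measure_ne_top _ _, ENNReal.toReal_mul,
      ENNReal.toReal_natCast] at h1
    rw [← Finset.mul_sum]
    simp only [measureReal_def]
    rw [h1, inv_mul_cancel_left₀ (Nat.cast_ne_zero.2 Fintype.card_ne_zero)]
  · refine Measure.ae_smul_measure ?_ _
    rw [ae_withDensity_iff (hd c)]
    refine ae_of_all _ fun x hx => ?_
    exact Set.mem_of_indicator_ne_zero hx

end MaximalEntropy

section Insertion

/-- The insertion map on pairs. -/
abbrev insertMap : G × Omega2 → Omega2 := fun gy => iota gy.1 gy.2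

/-- The insertion map, remembering the point of `G`. -/
def insertPair (z : G × Omega2) : G × Omega2 := (z.1, insertMap z)

lemma alphaG_succ_eq_card (g : G) (n : ℕ) :
    alphaG g (n + 1) = ((Finset.range (n + 1)).filter fun k => ¬ Free g k).card := by
  have : {k : ℕ | 1 ≤ k ∧ k ≤ n + 1 ∧
      ∃ p : Nat.Primes, ((k : ℕ) : ZMod ((p : ℕ) ^ 2)) = g p} =
      Nat.succ '' ((Finset.range (n + 1)).filter fun k => ¬ Free g k : Finset ℕ) := by
    ext k
    simp only [mem_ofPred_eq, Set.mem_image, Finset.coe_filter, Finset.mem_range, Free, not_not]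
    constructor
    · rintro ⟨h1, h2, p, hp⟩
      obtain ⟨j, rfl⟩ := Nat.exists_eq_add_of_le' h1
      exact ⟨j, ⟨by omega, p, hp⟩, rfl⟩
    · rintro ⟨j, ⟨hj, p, hp⟩, rfl⟩
      exact ⟨by omega, by omega, p, hp⟩
  rw [alphaG, this, Set.ncard_image_of_injective _ Nat.succ_injective, Set.ncard_coe_finset]

lemma iota_apply (g : G) (y : Omega2) (n : ℕ) :
    iota g y n = if Free g n then y (Nat.count (Free g) n) else false := by
  by_cases h : Free g n
  · have h' : ¬ ∃ p : Nat.Primes, ((n + 1 : ℕ) : ZMod ((p : ℕ) ^ 2)) = g p := h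
    rw [if_pos h, iota, if_neg h', alphaG_succ_eq_card]
    congr 1
    have h1 := Finset.card_filter_add_card_filter_not (s := Finset.range (n + 1)) (Free g)
    rw [← Nat.count_eq_card_filter_range, Nat.count_succ, if_pos h, Finset.card_range] at h1
    omega
  · have h' : ∃ p : Nat.Primes, ((n + 1 : ℕ) : ZMod ((p : ℕ) ^ 2)) = g p := not_not.1 h
    rw [if_neg h, iota, if_pos h']

lemma count_free_succ (g : G) (n : ℕ) :
    Nat.count (Free g) (n + 1) = Nat.count (Free (T1 g)) n + if g ∈ G1 then 0 else 1 := by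
  rw [Nat.count_succ']
  congr 1
  · congr 1
    funext k
    exact propext (free_succ g k)
  · by_cases h : g ∈ G1 <;> simp [free_zero, h]

lemma insertMap_skewT (z : G × Omega2) : insertMap (skewT z) = shift (insertMap z) := by
  obtain ⟨g, y⟩ := z
  funext n
  rw [shift, insertMap, insertMap, iota_apply, iota_apply, count_free_succ]
  by_cases h : g ∈ G1 <;> simp [skewT, h, free_succ, shift]

lemma skewT_fst (z : G × Omega2) : (skewT z).1 = T1 z.1 := by
  unfold skewT
  split_ifs <;> rfl

lemma insertPair_skewT (z : G × Omega2) : insertPair (skewT z) = rotShift (insertPair z) :=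
  Prod.ext (skewT_fst z) (insertMap_skewT z)

lemma measurable_skewT : Measurable skewT :=
  Measurable.ite (measurable_fst measurableSet_G1)
    ((measurable_T1.comp measurable_fst).prodMk measurable_snd)
    ((measurable_T1.comp measurable_fst).prodMk (measurable_shift.comp measurable_snd))

lemma measurable_count_free (n : ℕ) : Measurable fun g : G => Nat.count (Free g) n := by
  induction n with
  | zero => simp
  | succ n ih =>
    simp_rw [Nat.count_succ]
    exact ih.add (Measurable.ite (measurableSet_free n) measurable_const measurable_const)

lemma measurable_insertMap : Measurable insertMap := by
  refine measurable_pi_lambda _ fun n => ?_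
  simp_rw [insertMap, iota_apply]
  refine Measurable.ite (measurable_fst (measurableSet_free n)) ?_ measurable_const
  have h : Measurable fun q : ℕ × Omega2 => q.2 q.1 :=
    measurable_from_prod_countable_right fun k => measurable_pi_apply k
  exact h.comp (((measurable_count_free n).comp measurable_fst).prodMk measurable_snd)

lemma measurable_insertPair : Measurable insertPair :=
  measurable_fst.prodMk measurable_insertMap

lemma insertMap_mem_sqfFlow (z : G × Omega2) : insertMap z ∈ SqfFlow := by
  refine fun p => ⟨z.1 p, fun n hn => ?_⟩
  rw [insertMap, iota, if_pos ⟨p, hn⟩]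

/-- The points with infinitely many free positions. -/
def freeInf : Set (G × Omega2) := {z | {n | Free z.1 n}.Infinite}

lemma measurableSet_freeInf : MeasurableSet freeInf := by
  have : freeInf = ⋂ N : ℕ, ⋃ n : ℕ, {z : G × Omega2 | N < n ∧ Free z.1 n} := by
    ext z
    simp [freeInf, Set.infinite_iff_exists_gt, and_comm]
  rw [this]
  exact MeasurableSet.iInter fun N => MeasurableSet.iUnion fun n =>
    (MeasurableSet.const _).inter (measurable_fst (measurableSet_free n))

lemma injOn_insertPair : InjOn insertPair freeInf := by
  rintro ⟨g, y⟩ hz ⟨g', y'⟩ - h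
  obtain rfl : g = g' := congrArg Prod.fst h
  have h2 : iota g y = iota g y' := congrArg Prod.snd h
  refine Prod.ext rfl (funext fun k => ?_)
  have hF : Free g (Nat.nth (Free g) k) := Nat.nth_mem_of_infinite hz k
  have := congrFun h2 (Nat.nth (Free g) k)
  rwa [iota_apply, iota_apply, if_pos hF, if_pos hF, Nat.count_nth_of_infinite hz] at this

lemma exists_measurable_leftInvOn_insertPair :
    ∃ h : G × Omega2 → G × Omega2, Measurable h ∧ ∀ z ∈ freeInf, h (insertPair z) = z := by
  have : StandardBorelSpace freeInf := measurableSet_freeInf.standardBorel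
  have hinj : Function.Injective fun z : freeInf => insertPair z :=
    fun a b hab => Subtype.ext (injOn_insertPair a.2 b.2 hab)
  have hmeas : Measurable fun z : freeInf => insertPair z :=
    measurable_insertPair.comp measurable_subtype_coe
  obtain ⟨h, hh, hcomp⟩ := (hmeas.measurableEmbedding hinj).exists_measurable_extend
    measurable_subtype_coe fun _ => ⟨(0, fun _ => false)⟩
  exact ⟨h, hh, fun z hz => congrFun hcomp ⟨z, hz⟩⟩

end Insertion

section InvariantMeasures

variable {μ : Measure (G × Omega2)}

lemma isJoint_map_insertPair (hμ : MeasurePreserving skewT μ μ) : IsJoint (μ.map insertPair) where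
  mp := by
    refine ⟨measurable_rotShift, ?_⟩
    rw [Measure.map_map measurable_rotShift measurable_insertPair]
    conv_rhs => rw [← hμ.map_eq, Measure.map_map measurable_insertPair measurable_skewT]
    congr 1
    exact funext fun z => (insertPair_skewT z).symm
  supp := by
    rw [ae_all_iff]
    intro n
    rw [ae_map_iff measurable_insertPair.aemeasurable]
    · refine ae_of_all _ fun z hz => ?_
      change iota z.1 z.2 n = false
      rw [iota_apply]
      exact if_neg hz
    · have : {z : G × Omega2 | ¬ Free z.1 n → z.2 n = false} =
          (Prod.fst ⁻¹' {g | Free g n}) ∪ {z : G × Omega2 | z.2 n = false} := by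
        ext z
        simp [or_iff_not_imp_left]
      rw [this]
      exact (measurable_fst (measurableSet_free n)).union
        (measurableSet_eq_fun ((measurable_pi_apply n).comp measurable_snd) measurable_const)

lemma map_snd_map_insertPair : (μ.map insertPair).map Prod.snd = μ.map insertMap := by
  rw [Measure.map_map measurable_snd measurable_insertPair]
  rfl

lemma measurePreserving_map_fst (hμ : MeasurePreserving skewT μ μ) :
    MeasurePreserving T1 (μ.map Prod.fst) (μ.map Prod.fst) := by
  refine ⟨measurable_T1, ?_⟩
  rw [Measure.map_map measurable_T1 measurable_fst]
  conv_rhs => rw [← hμ.map_eq, Measure.map_map measurable_fst measurable_skewT]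
  congr 1
  exact funext fun z => (skewT_fst z).symm

lemma ae_mem_freeInf [IsProbabilityMeasure μ]
    (hμ : MeasurePreserving skewT μ μ) : ∀ᵐ z ∂μ, z ∈ freeInf := by
  have := Measure.isProbabilityMeasure_map (μ := μ) (f := Prod.fst) measurable_fst.aemeasurable
  exact ae_of_ae_map measurable_fst.aemeasurable (ae_infinite_free (measurePreserving_map_fst hμ))

lemma map_insertPair_injective [IsProbabilityMeasure μ]
    {μ' : Measure (G × Omega2)} [IsProbabilityMeasure μ']
    (hμ : MeasurePreserving skewT μ μ) (hμ' : MeasurePreserving skewT μ' μ')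
    (h : μ.map insertPair = μ'.map insertPair) : μ = μ' := by
  obtain ⟨r, hr, hinv⟩ := exists_measurable_leftInvOn_insertPair
  have key : ∀ (κ : Measure (G × Omega2)) [IsProbabilityMeasure κ],
      MeasurePreserving skewT κ κ → (κ.map insertPair).map r = κ := by
    intro κ _ hκ
    rw [Measure.map_map hr measurable_insertPair]
    conv_rhs => rw [← Measure.map_id (μ := κ)]
    exact Measure.map_congr ((ae_mem_freeInf hκ).mono fun z hz => hinv z hz)
  rw [← key μ hμ, h, key μ' hμ']

/-- The insertion map carries all of the entropy of the skew product. -/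
lemma ksEntropy_skewT [IsProbabilityMeasure μ] (hμ : MeasurePreserving skewT μ μ) :
    ksEntropy μ skewT = (procH (μ.map insertMap) shift firstBit : ℝ) := by
  obtain ⟨r, hr, hinv⟩ := exists_measurable_leftInvOn_insertPair
  have := Measure.isProbabilityMeasure_map (μ := μ) measurable_insertPair.aemeasurable
  have hJ := isJoint_map_insertPair hμ
  apply le_antisymm
  · refine ksEntropy_le fun k f hf => ?_
    have h1 : procH μ skewT f = procH μ skewT ((f ∘ r) ∘ insertPair) :=
      procH_congr_ae hμ ((ae_mem_freeInf hμ).mono fun z hz => congrArg f (hinv z hz).symm)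
    have h2 := procH_comp (μ := μ) (ν := μ.map insertPair) (f := f ∘ r)
      ⟨measurable_insertPair, rfl⟩ measurable_rotShift insertPair_skewT (hf.comp hr)
    rw [h1, h2, ← map_snd_map_insertPair]
    exact (le_ksEntropy _ _ (hf.comp hr)).trans (ksEntropy_rotShift_le hJ.mp)
  · rw [← procH_comp (μ := μ) ⟨measurable_insertMap, rfl⟩ measurable_shift insertMap_skewT
      measurable_firstBit]
    exact le_ksEntropy _ _ (measurable_firstBit.comp measurable_insertMap)

lemma ksEntropy_shift {m : Measure G} [IsProbabilityMeasure m] (hm : MeasurePreserving T1 m m)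
    {ν : Measure Omega2} [IsProbabilityMeasure ν] (hν : MeasurePreserving shift ν ν) :
    ksEntropy ν shift = (procH ν shift firstBit : ℝ) := by
  apply le_antisymm
  · refine ksEntropy_le fun k f hf => ?_
    have hmp : MeasurePreserving Prod.snd (m.prod ν) ν := measurePreserving_snd
    rw [← procH_comp (μ := m.prod ν) (T := rotShift) hmp measurable_shift (fun _ => rfl) hf]
    have := ksEntropy_rotShift_le (hm.prod hν : MeasurePreserving rotShift _ _)
    rw [hmp.map_eq] at this
    exact (le_ksEntropy _ _ (hf.comp measurable_snd)).trans this
  · exact le_ksEntropy _ _ measurable_firstBit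

end InvariantMeasures

section Bernoulli

open Real (log)

variable {ω : Measure Omega2}

lemma IsBernoulliHalf.measure_injOn (hω : IsBernoulliHalf ω) {s : Finset ℕ} {e : ℕ → ℕ}
    (he : InjOn e s) (v : ℕ → Bool) :
    ω {x | ∀ i ∈ s, x (e i) = v i} = (1 / 2 : ℝ≥0∞) ^ s.card := by
  rw [← Finset.card_image_of_injOn he, ← hω.2 _ (fun j => v (Function.invFunOn e s j))]
  congr 1
  ext x
  simp only [mem_ofPred_eq, Finset.mem_image, forall_exists_index, and_imp,
    forall_apply_eq_imp_iff₂]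
  refine forall₂_congr fun i hi => ?_
  rw [he.leftInvOn_invFunOn hi]

lemma wordBit_eq_iff_forall {n : ℕ} {x : Omega2} {w : Fin n → Fin 2} :
    wordBit n x = w ↔
      ∀ i ∈ Finset.range n, x i = if h : i < n then decide (w ⟨i, h⟩ = 1) else false := by
  constructor
  · rintro rfl i hi
    rw [dif_pos (Finset.mem_range.1 hi), wordBit_apply]
    cases x i <;> simp
  · intro h
    funext i
    have := h i (Finset.mem_range.2 i.2)
    rw [dif_pos i.2] at this
    rw [wordBit_apply, this]
    generalize w i = a
    fin_cases a <;> simp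

lemma IsBernoulliHalf.measurePreserving_shift (hω : IsBernoulliHalf ω) :
    MeasurePreserving shift ω ω := by
  have := hω.1
  have := Measure.isProbabilityMeasure_map (μ := ω) (f := shift) measurable_shift.aemeasurable
  refine ⟨measurable_shift, ext_of_words_snd fun n w => ?_⟩
  rw [measureReal_def, measureReal_def, Measure.map_apply measurable_shift
    (measurable_wordBit n (measurableSet_singleton w))]
  congr 1
  trans (1 / 2 : ℝ≥0∞) ^ (Finset.range n).card
  · rw [← hω.measure_injOn (Nat.succ_injective.injOn)
      (fun i => if h : i < n then decide (w ⟨i, h⟩ = 1) else false)]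
    congr 1
    ext x
    exact wordBit_eq_iff_forall
  · rw [← hω.2 _ (fun i => if h : i < n then decide (w ⟨i, h⟩ = 1) else false)]
    congr 1
    ext x
    exact wordBit_eq_iff_forall.symm

lemma IsHaarLike.measurePreserving_T1 {m : Measure G} (hm : IsHaarLike m) :
    MeasurePreserving T1 m m := by
  convert hm.2 (fun _ => -1) using 1
  funext g p
  change g p - 1 = -1 + g p
  ring

lemma measurePreserving_skewT_prod {m : Measure G} (hm : IsHaarLike m) (hω : IsBernoulliHalf ω) :
    MeasurePreserving skewT (m.prod ω) (m.prod ω) := by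
  have := hm.1
  have := hω.1
  have h : skewT = fun z : G × Omega2 => (T1 z.1, (skewT z).2) :=
    funext fun z => Prod.ext (skewT_fst z) rfl
  rw [h]
  refine hm.measurePreserving_T1.skew_product (g := fun g y => (skewT (g, y)).2)
    (measurable_snd.comp measurable_skewT) (ae_of_all _ fun g => ?_)
  by_cases hg : g ∈ G1
  · simp [skewT, hg]
  · simpa [skewT, hg] using hω.measurePreserving_shift.map_eq

lemma IsBernoulliHalf.negMulLog_wordBit (hω : IsBernoulliHalf ω) (g : G) (n : ℕ)
    (w : Fin n → Fin 2) :
    Real.negMulLog (ω.real {y | wordBit n (iota g y) = w}) =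
      ω.real {y | wordBit n (iota g y) = w} * (Nat.count (Free g) n * log 2) := by
  set v : ℕ → Bool := fun i => if h : i < n then decide (w ⟨i, h⟩ = 1) else false with hv
  by_cases hbad : ∃ i ∈ Finset.range n, ¬ Free g i ∧ v i = true
  · have : {y | wordBit n (iota g y) = w} = ∅ := by
      refine eq_empty_of_forall_notMem fun y hy => ?_
      obtain ⟨i, hi, hF, hvi⟩ := hbad
      have := (wordBit_eq_iff_forall.1 hy) i hi
      rw [iota_apply, if_neg hF] at this
      exact absurd (this.trans hvi) (by simp)
    simp [this]
  · have : {y | wordBit n (iota g y) = w} =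
        {y | ∀ i ∈ (Finset.range n).filter (Free g), y (Nat.count (Free g) i) = v i} := by
      ext y
      simp only [mem_ofPred_eq, wordBit_eq_iff_forall, Finset.mem_filter, iota_apply]
      constructor
      · intro h i hi
        have := h i hi.1
        rwa [if_pos hi.2] at this
      · intro h i hi
        by_cases hF : Free g i
        · rw [if_pos hF]
          exact h i ⟨hi, hF⟩
        · rw [if_neg hF]
          by_contra hne
          exact hbad ⟨i, hi, hF, eq_true_of_ne_false fun h' => hne h'.symm⟩
    rw [this, measureReal_def, hω.measure_injOn]
    · rw [Nat.count_eq_card_filter_range, Real.negMulLog, ENNReal.toReal_pow]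
      simp [Real.log_pow]
    · intro i hi j hj hij
      simp only [Finset.coe_filter, mem_ofPred_eq] at hi hj
      exact Nat.count_injective hi.2 hj.2 hij

lemma integral_count_free {m : Measure G} [IsProbabilityMeasure m] (hm : MeasurePreserving T1 m m)
    (n : ℕ) : Integrable (fun g => (Nat.count (Free g) n : ℝ)) m ∧
      ∫ g, (Nat.count (Free g) n : ℝ) ∂m = n * m.real G1ᶜ := by
  have hind : (fun g : G => (Nat.count (Free g) n : ℝ)) = fun g =>
      ∑ i ∈ Finset.range n, ({g | Free g i} : Set G).indicator (fun _ => (1 : ℝ)) g := by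
    funext g
    rw [Nat.count_eq_card_filter_range, Finset.card_filter]
    push_cast
    exact Finset.sum_congr rfl fun i _ => by simp [Set.indicator_apply]
  have h_int : ∀ i ∈ Finset.range n,
      Integrable (({g | Free g i} : Set G).indicator (fun _ => (1 : ℝ))) m := fun i _ =>
    (integrable_const 1).indicator (measurableSet_free i)
  rw [hind]
  refine ⟨integrable_finsetSum _ h_int, ?_⟩
  rw [integral_finsetSum _ h_int]
  have : ∀ i, m.real {g | Free g i} = m.real G1ᶜ := by
    intro i
    have hset : {g | Free g i} = T1^[i] ⁻¹' G1ᶜ := by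
      ext g
      rw [mem_ofPred_eq, mem_preimage, ← free_zero, ← free_add, Nat.zero_add]
    rw [hset, (hm.iterate i).measureReal_preimage measurableSet_G1.compl.nullMeasurableSet]
  have hterm : ∀ i ∈ Finset.range n,
      ∫ g, ({g | Free g i} : Set G).indicator (fun _ => (1 : ℝ)) g ∂m = m.real G1ᶜ := by
    intro i _
    refine (integral_indicator_const 1 (measurableSet_free i)).trans ?_
    rw [this, smul_eq_mul, mul_one]
  exact (Finset.sum_congr rfl hterm).trans (by simp)

lemma le_procH_map_insertMap {m : Measure G} (hm : IsHaarLike m) (hω : IsBernoulliHalf ω) :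
    m.real G1ᶜ * log 2 ≤ procH ((m.prod ω).map insertMap) shift firstBit := by
  have := hm.1
  have := hω.1
  have := Measure.isProbabilityMeasure_map (μ := m.prod ω) measurable_insertMap.aemeasurable
  have hT1 := hm.measurePreserving_T1
  refine le_procH fun n => ?_
  set u : (Fin n → Fin 2) → G → ℝ := fun w g => ω.real {y | wordBit n (iota g y) = w} with hu
  have hset : ∀ w, MeasurableSet {z : G × Omega2 | wordBit n (insertMap z) = w} := fun w =>
    ((measurable_wordBit n).comp measurable_insertMap) (measurableSet_singleton w)
  have humeas : ∀ w, Measurable (u w) := fun w =>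
    (measurable_measure_prodMk_left (hset w)).ennreal_toReal
  have huint : ∀ w, Integrable (u w) m := fun w =>
    Integrable.of_bound (humeas w).aestronglyMeasurable 1 (ae_of_all _ fun g => by
      rw [Real.norm_of_nonneg measureReal_nonneg]
      exact measureReal_le_one)
  have hwm : ∀ w, (((m.prod ω).map insertMap) (wordBit n ⁻¹' {w})).toReal = ∫ g, u w g ∂m := by
    intro w
    rw [Measure.map_apply measurable_insertMap (measurable_wordBit n (measurableSet_singleton w))]
    exact (congrArg ENNReal.toReal (Measure.prod_apply (hset w))).trans
      (integral_toReal (measurable_measure_prodMk_left (hset w)).aemeasurable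
        (ae_of_all _ fun g => measure_lt_top _ _)).symm
  have hnint : ∀ w, Integrable (fun g => Real.negMulLog (u w g)) m := fun w => by
    simp_rw [hu, hω.negMulLog_wordBit]
    refine ((integral_count_free hT1 n).1.mul_const (log 2)).bdd_mul
      (humeas w).aestronglyMeasurable (c := 1) (ae_of_all _ fun g => ?_)
    rw [Real.norm_of_nonneg measureReal_nonneg]
    exact measureReal_le_one
  have hjensen : ∀ w, ∫ g, Real.negMulLog (u w g) ∂m ≤ Real.negMulLog (∫ g, u w g ∂m) := fun w =>
    Real.concaveOn_negMulLog.le_map_integral Real.continuous_negMulLog.continuousOn isClosed_Ici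
      (ae_of_all _ fun g => measureReal_nonneg) (huint w) (hnint w)
  have hsum : ∀ g, ∑ w, Real.negMulLog (u w g) = Nat.count (Free g) n * log 2 := by
    intro g
    simp_rw [hu, hω.negMulLog_wordBit, ← Finset.sum_mul]
    have hone := sum_measureReal_fiber ω (f := fun y => wordBit n (iota g y))
      ((measurable_wordBit n).comp (measurable_insertMap.comp measurable_prodMk_left))
    exact (congrArg (· * _) hone).trans (one_mul _)
  calc n * (m.real G1ᶜ * log 2) = ∫ g, ∑ w, Real.negMulLog (u w g) ∂m := by
        simp_rw [hsum]
        rw [integral_mul_const, (integral_count_free hT1 n).2, mul_assoc]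
    _ = ∑ w, ∫ g, Real.negMulLog (u w g) ∂m := integral_finsetSum _ fun w _ => hnint w
    _ ≤ ∑ w, Real.negMulLog (∫ g, u w g ∂m) := Finset.sum_le_sum fun w _ => hjensen w
    _ = partH ((m.prod ω).map insertMap) (wordBit n) := by
        rw [partH]
        exact Finset.sum_congr rfl fun w _ => by rw [hwm]

end Bernoulli

/-- `m × ω_{(1/2,1/2)}` is the unique measure of maximal entropy for the
skew product `(G × Ω⁽²⁾, T)`, and its pushforward `ι_*(m × ω_{(1/2,1/2)})` under the
insertion map is the unique measure of maximal entropy for the squarefree flow `(X, σ)`. -/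
theorem unique_mme_description (m : Measure G) (hm : IsHaarLike m)
    (ω : Measure Omega2) (hω : IsBernoulliHalf ω) :
    (MeasurePreserving skewT (m.prod ω) (m.prod ω) ∧
      ksEntropy (m.prod ω) skewT =
        (⨆ (μ : Measure (G × Omega2)) (_ : IsProbabilityMeasure μ)
          (_ : MeasurePreserving skewT μ μ), ksEntropy μ skewT) ∧
      ∀ μ : Measure (G × Omega2), IsProbabilityMeasure μ → MeasurePreserving skewT μ μ →
        ksEntropy μ skewT = ksEntropy (m.prod ω) skewT → μ = m.prod ω) ∧
    (((m.prod ω).map fun gy : G × Omega2 => iota gy.1 gy.2) SqfFlow = 1 ∧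
      MeasurePreserving shift ((m.prod ω).map fun gy : G × Omega2 => iota gy.1 gy.2)
        ((m.prod ω).map fun gy : G × Omega2 => iota gy.1 gy.2) ∧
      ksEntropy ((m.prod ω).map fun gy : G × Omega2 => iota gy.1 gy.2) shift =
        (⨆ (ν : Measure Omega2) (_ : IsProbabilityMeasure ν)
          (_ : MeasurePreserving shift ν ν) (_ : ν SqfFlow = 1), ksEntropy ν shift) ∧
      ∀ ν : Measure Omega2, IsProbabilityMeasure ν → MeasurePreserving shift ν ν →
        ν SqfFlow = 1 →
        ksEntropy ν shift = ksEntropy ((m.prod ω).map fun gy : G × Omega2 => iota gy.1 gy.2) shift →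
        ν = (m.prod ω).map fun gy : G × Omega2 => iota gy.1 gy.2) := by
  have := hm.1
  have := hω.1
  have hT1 := hm.measurePreserving_T1
  have h₀ := measurePreserving_skewT_prod hm hω
  have hlow := le_procH_map_insertMap hm hω
  have hprob : ∀ μ : Measure (G × Omega2), IsProbabilityMeasure μ →
      IsProbabilityMeasure (μ.map insertMap) := fun μ _ =>
    Measure.isProbabilityMeasure_map measurable_insertMap.aemeasurable
  have := hprob (m.prod ω) inferInstance
  have hprob' : ∀ μ : Measure (G × Omega2), IsProbabilityMeasure μ →
      IsProbabilityMeasure (μ.map insertPair) := fun μ _ =>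
    Measure.isProbabilityMeasure_map measurable_insertPair.aemeasurable
  have := hprob' (m.prod ω) inferInstance
  have hsh : MeasurePreserving shift ((m.prod ω).map insertMap) ((m.prod ω).map insertMap) := by
    refine ⟨measurable_shift, ?_⟩
    rw [Measure.map_map measurable_shift measurable_insertMap]
    conv_rhs => rw [← h₀.map_eq, Measure.map_map measurable_insertMap measurable_skewT]
    congr 1
    exact funext fun z => (insertMap_skewT z).symm
  have hX : ((m.prod ω).map insertMap) SqfFlow = 1 := by
    rw [Measure.map_apply measurable_insertMap measurableSet_sqfFlow,
      eq_univ_of_forall (s := insertMap ⁻¹' SqfFlow) insertMap_mem_sqfFlow, measure_univ]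
  have hup : ∀ μ : Measure (G × Omega2), IsProbabilityMeasure μ → MeasurePreserving skewT μ μ →
      procH (μ.map insertMap) shift firstBit ≤ m.real G1ᶜ * Real.log 2 := by
    intro μ _ hμ
    have := hprob' μ inferInstance
    rw [← map_snd_map_insertPair]
    exact (isJoint_map_insertPair hμ).procH_le hT1
  refine ⟨⟨h₀, le_antisymm ?_ ?_, ?_⟩, hX, hsh, le_antisymm ?_ ?_, ?_⟩
  · exact le_iSup₂_of_le (m.prod ω) inferInstance (le_iSup_of_le h₀ le_rfl)
  · refine iSup_le fun μ => iSup₂_le fun _ hμ => ?_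
    rw [ksEntropy_skewT hμ, ksEntropy_skewT h₀, EReal.coe_le_coe_iff]
    exact (hup μ inferInstance hμ).trans hlow
  · intro μ _ hμ he
    have := hprob' μ inferInstance
    rw [ksEntropy_skewT hμ, ksEntropy_skewT h₀, EReal.coe_eq_coe_iff] at he
    refine map_insertPair_injective hμ h₀ (IsJoint.eq hT1 (isJoint_map_insertPair hμ)
      (isJoint_map_insertPair h₀) ?_ ?_)
    · rwa [map_snd_map_insertPair, he]
    · rwa [map_snd_map_insertPair]
  · exact le_iSup₂_of_le ((m.prod ω).map insertMap) inferInstance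
      (le_iSup₂_of_le hsh hX le_rfl)
  · refine iSup_le fun ν => iSup₂_le fun _ hν => iSup_le fun hνX => ?_
    rw [ksEntropy_shift hT1 hν, ksEntropy_shift hT1 hsh, EReal.coe_le_coe_iff]
    exact (procH_le_of_decomp hT1 (exists_decomp_of_sqfFlow hν hνX)).trans hlow
  · intro ν _ hν hνX he
    rw [ksEntropy_shift hT1 hν, ksEntropy_shift hT1 hsh, EReal.coe_eq_coe_iff] at he
    exact eq_of_decomp hT1 (exists_decomp_of_sqfFlow hν hνX) (exists_decomp_of_sqfFlow hsh hX)
      (he ▸ hlow) hlow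

end
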